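/- Order bound for minimal bases of joint covariants: let V = S_{n₁} ⊕ … ⊕ S_{n_s} be a space of binary forms and, for each i, let μ_i be the maximal order of an element of a minimal basis of Cov(S_{n_i}). Then every element h of a minimal basis of Cov(V) satisfies ord(h) ≤ μ₁ + … + μ_s. -/

import Mathlib

noncomputable section
set_option synthInstance.maxHeartbeats 1000000
set_option maxHeartbeats 1000000
open MvPolynomial

abbrev SL2 : Type := Matrix.SpecialLinearGroup (Fin 2) ℂ
abbrev Var {ι : Type} (ν : ι → ℕ) : Type := (Σ i : ι, Fin (ν i + 1)) ⊕ Fin 2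
abbrev CoordRing {ι : Type} (ν : ι → ℕ) : Type := MvPolynomial (Var ν) ℂ
def form (n : ℕ) (a : Fin (n + 1) → ℂ) : MvPolynomial (Fin 2) ℂ :=
  ∑ i : Fin (n + 1), MvPolynomial.C (a i) * X 0 ^ (n - (i : ℕ)) * X 1 ^ (i : ℕ)
def subst2 (g : SL2) : MvPolynomial (Fin 2) ℂ →ₐ[ℂ] MvPolynomial (Fin 2) ℂ :=
  aeval fun i => ∑ j : Fin 2, MvPolynomial.C ((g⁻¹).1 i j) * X j
def coeffOf (n : ℕ) (p : MvPolynomial (Fin 2) ℂ) (i : Fin (n + 1)) : ℂ :=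
  MvPolynomial.coeff (Finsupp.single 0 (n - (i : ℕ)) + Finsupp.single 1 ((i : ℕ))) p
def coeffAct (g : SL2) (n : ℕ) (a : Fin (n + 1) → ℂ) : Fin (n + 1) → ℂ :=
  coeffOf n (subst2 g (form n a))
def ptAct {ι : Type} (ν : ι → ℕ) (g : SL2) (pt : Var ν → ℂ) : Var ν → ℂ :=
  Sum.elim
    (fun c => coeffAct g (ν c.1) (fun k => pt (Sum.inl ⟨c.1, k⟩)) c.2)
    (fun i => ∑ j : Fin 2, (g).1 i j * pt (Sum.inr j))
def Covariants {ι : Type} (ν : ι → ℕ) : Subalgebra ℂ (CoordRing ν) where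
  carrier := {p | ∀ (g : SL2) (pt : Var ν → ℂ), eval (ptAct ν g pt) p = eval pt p}
  mul_mem' := by intro a b ha hb g pt; simp only [map_mul, ha g pt, hb g pt]
  one_mem' := by intro g pt; simp
  add_mem' := by intro a b ha hb g pt; simp only [map_add, ha g pt, hb g pt]
  zero_mem' := by intro g pt; simp
  algebraMap_mem' := by intro c g pt; simp [MvPolynomial.algebraMap_eq]
def wBi {ι : Type} (ν : ι → ℕ) : Var ν → ℕ × ℕ :=
  Sum.elim (fun _ => (1, 0)) (fun _ => (0, 1))

-- new defs to test
/-- The set of covariants that are bihomogeneous of degree `d` and order `k`,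
i.e. the homogeneous component `Cov_{d,k}(V)`. -/
def CovHom {ι : Type} (ν : ι → ℕ) (d k : ℕ) : Set (CoordRing ν) :=
  {h | h ∈ Covariants ν ∧ h.IsWeightedHomogeneous (wBi ν) (d, k)}

/-- A covariant of degree `d` and order `k` is *reducible* if it belongs to the
subalgebra generated by the homogeneous covariants of degree `d' ≤ d` and order
`k' ≤ k` with `(d',k') ≠ (d,k)`. -/
def IsReducibleAt {ι : Type} (ν : ι → ℕ) (d k : ℕ) (h : CoordRing ν) : Prop :=
  h ∈ Algebra.adjoin ℂ
    {p | ∃ d' k' : ℕ, d' ≤ d ∧ k' ≤ k ∧ (d', k') ≠ (d, k) ∧ p ∈ CovHom ν d' k'}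

/-- The ideal `C₊` of `Cov(V)` spanned by the homogeneous components of positive
total degree, as a `ℂ`-submodule of `Cov(V)`. -/
def Cplus {ι : Type} (ν : ι → ℕ) : Submodule ℂ ↥(Covariants ν) :=
  Submodule.span ℂ
    {h | ∃ d k : ℕ, 0 < d + k ∧ (h : CoordRing ν).IsWeightedHomogeneous (wBi ν) (d, k)}

/-- The `ℂ`-submodule `C₊²` of `Cov(V)` spanned by products of two elements of `C₊`. -/
def CplusSq {ι : Type} (ν : ι → ℕ) : Submodule ℂ ↥(Covariants ν) :=
  Submodule.span ℂ {h | ∃ x ∈ Cplus ν, ∃ y ∈ Cplus ν, h = x * y}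

/-- A *minimal basis* of `Cov(V)`: a family of bihomogeneous covariants of positive
total degree whose image in the quotient vector space `C₊/C₊²` is a `ℂ`-basis
(rendered as: the images in `Cov(V)/C₊²` are linearly independent and span the
image of `C₊`). -/
def IsMinimalBasis {ι : Type} (ν : ι → ℕ) {κ : Type} (B : κ → ↥(Covariants ν)) : Prop :=
  (∀ x, ∃ d k : ℕ, 0 < d + k ∧
      ((B x : CoordRing ν)).IsWeightedHomogeneous (wBi ν) (d, k)) ∧
  LinearIndependent ℂ (fun x => (CplusSq ν).mkQ (B x)) ∧
  Submodule.span ℂ (Set.range fun x => (CplusSq ν).mkQ (B x))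
    = (Cplus ν).map (CplusSq ν).mkQ

/-- A pair of locally nilpotent operators `E`, `F` acting on a module with a family of weight
spaces `𝒜` as the raising and lowering operators of `sl₂`. -/
structure Sl2Graded {M : Type*} [AddCommGroup M] [Module ℂ M] (𝒜 : ℤ → Submodule ℂ M)
    (E F : Module.End ℂ M) : Prop where
  raise : ∀ {p : ℤ} {x : M}, x ∈ 𝒜 p → E x ∈ 𝒜 (p + 2)
  lower : ∀ {p : ℤ} {x : M}, x ∈ 𝒜 p → F x ∈ 𝒜 (p - 2)
  comm : ∀ {p : ℤ} {x : M}, x ∈ 𝒜 p → E (F x) = F (E x) + (p : ℂ) • x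
  nilE : ∀ x : M, ∃ n : ℕ, (E ^ n) x = 0
  nilF : ∀ x : M, ∃ n : ℕ, (F ^ n) x = 0

namespace Sl2Graded

section Module

variable {M : Type*} [AddCommGroup M] [Module ℂ M] {𝒜 : ℤ → Submodule ℂ M}
  {E F : Module.End ℂ M}

lemma raise_pow (h : Sl2Graded 𝒜 E F) {p : ℤ} {x : M} (hx : x ∈ 𝒜 p) (n : ℕ) :
    (E ^ n) x ∈ 𝒜 (p + 2 * n) := by
  induction n with
  | zero => simpa using hx
  | succ n ih =>
    rw [pow_succ', Module.End.mul_apply]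
    convert h.raise ih using 2
    push_cast; ring

lemma lower_pow (h : Sl2Graded 𝒜 E F) {p : ℤ} {x : M} (hx : x ∈ 𝒜 p) (n : ℕ) :
    (F ^ n) x ∈ 𝒜 (p - 2 * n) := by
  induction n with
  | zero => simpa using hx
  | succ n ih =>
    rw [pow_succ', Module.End.mul_apply]
    convert h.lower ih using 2
    push_cast; ring

lemma pow_raise_lower (h : Sl2Graded 𝒜 E F) {p : ℤ} {x : M} (hx : x ∈ 𝒜 p) (n : ℕ) :
    (E ^ (n + 1)) (F x) = F ((E ^ (n + 1)) x) + (((n : ℂ) + 1) * (p + n)) • (E ^ n) x := by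
  induction n with
  | zero => simpa using h.comm hx
  | succ n ih =>
    have e := h.comm (h.raise_pow hx (n + 1))
    rw [pow_succ' E (n + 1), Module.End.mul_apply, ih, map_add, map_smul, e,
      Module.End.mul_apply]
    rw [← Module.End.mul_apply E (E ^ n), ← pow_succ', add_assoc, ← add_smul]
    congr 2
    push_cast; ring

lemma raise_pow_lower (h : Sl2Graded 𝒜 E F) {p : ℤ} {x : M} (hx : x ∈ 𝒜 p) (n : ℕ) :
    E ((F ^ (n + 1)) x) = (F ^ (n + 1)) (E x) + (((n : ℂ) + 1) * (p - n)) • (F ^ n) x := by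
  induction n with
  | zero => simpa using h.comm hx
  | succ n ih =>
    have e := h.comm (h.lower_pow hx (n + 1))
    rw [pow_succ' F (n + 1), Module.End.mul_apply, e, ih, map_add, map_smul,
      Module.End.mul_apply]
    rw [← Module.End.mul_apply F (F ^ n), ← pow_succ', add_assoc, ← add_smul]
    congr 2
    push_cast; ring

lemma eq_zero_of_raise_lower (h : Sl2Graded 𝒜 E F) {p : ℤ} (hp : 0 < p) {w : M}
    (hw : w ∈ 𝒜 p) (hEF : E (F w) = 0) : w = 0 := by
  obtain ⟨n, hn⟩ := h.nilE w
  induction n with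
  | zero => simpa using hn
  | succ n ih =>
    apply ih
    have e := h.pow_raise_lower hw n
    rw [hn, map_zero, zero_add, pow_succ, Module.End.mul_apply, hEF, map_zero] at e
    refine (smul_eq_zero.mp e.symm).resolve_left ?_
    exact_mod_cast (by positivity : ((n : ℤ) + 1) * (p + n) ≠ 0)

lemma eq_zero_of_raise_pow (h : Sl2Graded 𝒜 E F) {q i : ℕ} (hi : i ≤ q) {x : M}
    (hx : x ∈ 𝒜 (-q)) (hE : (E ^ i) x = 0) : x = 0 := by
  obtain ⟨N, hN⟩ := h.nilF x
  induction N generalizing q i x with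
  | zero => simpa using hN
  | succ N ih =>
    have hF : F x = 0 := by
      refine ih (q := q + 2) (i := i + 1) (by omega) ?_ ?_ ?_
      · convert h.lower hx using 2
        push_cast; ring
      · rw [h.pow_raise_lower hx, pow_succ', Module.End.mul_apply, hE]
        simp
      · rw [← Module.End.mul_apply, ← pow_succ, hN]
    clear ih hN
    induction i with
    | zero => simpa using hE
    | succ i ih =>
      refine ih (by omega) ?_
      have e := h.pow_raise_lower hx i
      rw [hF, hE] at e
      simp only [map_zero, zero_add] at e
      refine (smul_eq_zero.mp e.symm).resolve_left ?_
      have : ((i : ℤ) + 1) * (-q + i) ≠ 0 :=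
        mul_ne_zero (by omega) (by omega)
      exact_mod_cast this

lemma eq_zero_of_neg (h : Sl2Graded 𝒜 E F) {p : ℤ} (hp : p < 0) {x : M}
    (hx : x ∈ 𝒜 p) (hE : E x = 0) : x = 0 := by
  obtain ⟨q, rfl⟩ : ∃ q : ℕ, p = -q := ⟨p.natAbs, by omega⟩
  exact h.eq_zero_of_raise_pow (i := 1) (by omega) hx (by simpa using hE)

lemma lower_pow_eq_zero (h : Sl2Graded 𝒜 E F) {m : ℤ} {w : M} (hw : w ∈ 𝒜 m)
    (hE : E w = 0) {b : ℕ} (hb : m < b) : (F ^ b) w = 0 := by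
  rcases lt_or_ge m 0 with hm | hm
  · rw [h.eq_zero_of_neg hm hw hE, map_zero]
  · lift m to ℕ using hm
    have key : (F ^ (m + 1)) w = 0 := by
      refine h.eq_zero_of_neg ?_ (h.lower_pow hw (m + 1)) ?_
      · push_cast; omega
      · rw [h.raise_pow_lower hw, hE]; simp
    obtain ⟨c, rfl⟩ : ∃ c, b = c + (m + 1) := ⟨b - (m + 1), by omega⟩
    rw [pow_add, Module.End.mul_apply, key, map_zero]

lemma raise_lower_pow (h : Sl2Graded 𝒜 E F) {m : ℤ} {w : M} (hw : w ∈ 𝒜 m)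
    (hE : E w = 0) (i j : ℕ) :
    (E ^ j) ((F ^ (i + j)) w) =
      ((∏ l ∈ Finset.range j, (((i : ℝ) + l + 1) * (m - i - l)) : ℝ) : ℂ) • (F ^ i) w := by
  induction j with
  | zero => simp
  | succ j ih =>
    rw [pow_succ, Module.End.mul_apply, ← add_assoc, h.raise_pow_lower hw, hE, map_zero,
      zero_add, map_smul, ih, smul_smul, Finset.prod_range_succ]
    congr 1
    push_cast; ring

lemma prod_pos {m : ℤ} {i j : ℕ} (hm : (i + j : ℤ) ≤ m) :
    0 < ∏ l ∈ Finset.range j, (((i : ℝ) + l + 1) * (m - i - l)) := by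
  refine Finset.prod_pos fun l hl => mul_pos (by positivity) ?_
  have : (0 : ℤ) < m - i - l := by have := Finset.mem_range.mp hl; omega
  exact_mod_cast this

/-- Elements killed by `E ^ n` are sums of descendants `F ^ i w`, `i < n`, of highest weight
vectors `w`. -/
lemma mem_span_lower (h : Sl2Graded 𝒜 E F) {N : Submodule ℂ M}
    (hNE : ∀ x ∈ N, E x ∈ N) (hNF : ∀ x ∈ N, F x ∈ N) {p : ℤ} {x : M} (hxN : x ∈ N)
    (hx : x ∈ 𝒜 p) {n : ℕ} (hn : (E ^ n) x = 0) :
    x ∈ Submodule.span ℂ {y | ∃ i < n, ∃ w ∈ N, w ∈ 𝒜 (p + 2 * i) ∧ E w = 0 ∧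
      y = (F ^ i) w} := by
  have hNE' : ∀ n : ℕ, ∀ x ∈ N, (E ^ n) x ∈ N := by
    intro n
    induction n with
    | zero => simp
    | succ n ih => intro x hx; rw [pow_succ', Module.End.mul_apply]; exact hNE _ (ih x hx)
  have hNF' : ∀ n : ℕ, ∀ x ∈ N, (F ^ n) x ∈ N := by
    intro n
    induction n with
    | zero => simp
    | succ n ih => intro x hx; rw [pow_succ', Module.End.mul_apply]; exact hNF _ (ih x hx)
  have nonneg : ∀ (n : ℕ) {p : ℤ} {x : M}, 0 ≤ p → x ∈ N → x ∈ 𝒜 p → (E ^ n) x = 0 →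
      x ∈ Submodule.span ℂ {y | ∃ i < n, ∃ w ∈ N, w ∈ 𝒜 (p + 2 * i) ∧ E w = 0 ∧
        y = (F ^ i) w} := by
    intro n
    induction n with
    | zero => intro p x _ _ _ hn; simp at hn; simp [hn]
    | succ n ih =>
      intro p x hp hxN hx hn
      have hy := h.raise_pow hx n
      have hEy : E ((E ^ n) x) = 0 := by rw [← Module.End.mul_apply, ← pow_succ', hn]
      have e := h.raise_lower_pow hy hEy 0 n
      rw [zero_add, pow_zero, Module.End.one_apply] at e
      set c : ℝ := ∏ l ∈ Finset.range n,
        (((0 : ℕ) : ℝ) + l + 1) * (((p + 2 * n : ℤ) : ℝ) - (0 : ℕ) - l) with hc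
      have hcpos : 0 < c := prod_pos (by push_cast; omega)
      have hc0 : (c : ℂ) ≠ 0 := by exact_mod_cast hcpos.ne'
      have hw : (F ^ n) ((E ^ n) x) ∈ 𝒜 p := by
        have := h.lower_pow hy n
        rwa [add_sub_cancel_right] at this
      have hz : x - (c : ℂ)⁻¹ • (F ^ n) ((E ^ n) x) ∈ Submodule.span ℂ
          {y | ∃ i < n, ∃ w ∈ N, w ∈ 𝒜 (p + 2 * i) ∧ E w = 0 ∧ y = (F ^ i) w} := by
        refine ih hp ?_ ?_ ?_
        · exact N.sub_mem hxN (N.smul_mem _ (hNF' _ _ (hNE' _ _ hxN)))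
        · exact (𝒜 p).sub_mem hx ((𝒜 p).smul_mem _ hw)
        · rw [map_sub, map_smul, e, smul_smul, inv_mul_cancel₀ hc0, one_smul, sub_self]
      rw [← sub_add_cancel x ((c : ℂ)⁻¹ • (F ^ n) ((E ^ n) x))]
      refine Submodule.add_mem _ (Submodule.span_mono ?_ hz) (Submodule.smul_mem _ _
        (Submodule.subset_span ⟨n, by omega, _, hNE' n _ hxN, hy, hEy, rfl⟩))
      rintro y ⟨i, hi, r⟩
      exact ⟨i, by omega, r⟩
  rcases le_or_gt 0 p with hp | hp
  · exact nonneg n hp hxN hx hn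
  obtain ⟨q, rfl⟩ : ∃ q : ℕ, p = -q := ⟨p.natAbs, by omega⟩
  rcases le_or_gt n q with hnq | hnq
  · rw [h.eq_zero_of_raise_pow hnq hx hn]
    exact Submodule.zero_mem _
  have hy : (E ^ q) x ∈ 𝒜 q := by
    have := h.raise_pow hx q
    convert this using 2
    ring
  have hspan := nonneg (n - q) (by omega) (hNE' q _ hxN) hy
    (by rw [← Module.End.mul_apply, ← pow_add, Nat.sub_add_cancel hnq.le, hn])
  have hle : Submodule.span ℂ {y | ∃ i < n - q, ∃ w ∈ N, w ∈ 𝒜 (q + 2 * i) ∧ E w = 0 ∧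
      y = (F ^ i) w} ≤ Submodule.map (E ^ q) (𝒜 (-q) ⊓ Submodule.span ℂ {y | ∃ i < n, ∃ w ∈ N,
        w ∈ 𝒜 (-q + 2 * i) ∧ E w = 0 ∧ y = (F ^ i) w}) := by
    rw [Submodule.span_le]
    rintro y ⟨i, hi, w, hwN, hw, hEw, rfl⟩
    have e := h.raise_lower_pow hw hEw i q
    have hc := prod_pos (m := (q + 2 * i : ℤ)) (i := i) (j := q) (by omega)
    set c : ℝ := ∏ l ∈ Finset.range q, ((i : ℝ) + l + 1) * (((q + 2 * i : ℤ) : ℝ) - i - l)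
    have hc0 : (c : ℂ) ≠ 0 := by exact_mod_cast hc.ne'
    refine ⟨(c : ℂ)⁻¹ • (F ^ (i + q)) w, ⟨?_, ?_⟩, ?_⟩
    · refine Submodule.smul_mem _ _ ?_
      convert h.lower_pow hw (i + q) using 2
      push_cast; ring
    · refine Submodule.smul_mem _ _ (Submodule.subset_span ⟨i + q, by omega, w, hwN, ?_, hEw, rfl⟩)
      convert hw using 2
      push_cast; ring
    · rw [map_smul, e, smul_smul, inv_mul_cancel₀ hc0, one_smul]
  obtain ⟨z, ⟨hz, hzs⟩, hzx⟩ := hle hspan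
  have : x - z = 0 := h.eq_zero_of_raise_pow le_rfl ((𝒜 _).sub_mem hx hz)
    (by rw [map_sub, hzx, sub_self])
  rwa [sub_eq_zero.mp this]

end Module
end Sl2Graded

namespace Sl2Graded

section Ring

variable {R : Type*} [CommRing R] [Algebra ℂ R] {𝒜 : ℤ → Submodule ℂ R} {E F : Module.End ℂ R}

lemma raise_lower_pow_succ (h : Sl2Graded 𝒜 E F) {m : ℤ} {w : R} (hw : w ∈ 𝒜 m)
    (hE : E w = 0) (n : ℕ) :
    E ((F ^ (n + 1)) w) = (((n : ℂ) + 1) * (m - n)) • (F ^ n) w := by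
  rw [h.raise_pow_lower hw, hE, map_zero, zero_add]

/-- The `b`-th transvectant of two highest weight vectors, with coefficients of alternating
sign. -/
lemma exists_transvectant (h : Sl2Graded 𝒜 E F) (dE : ∀ x y, E (x * y) = x * E y + y * E x)
    {m n : ℤ} {w v : R} (hw : w ∈ 𝒜 m) (hEw : E w = 0) (hv : v ∈ 𝒜 n) (hEv : E v = 0)
    {b : ℕ} (hbm : b ≤ m) (hbn : b ≤ n) :
    ∃ c : ℕ → ℝ, c 0 = 1 ∧ (∀ j ≤ b, 0 ≤ c j) ∧
      E (∑ j ∈ Finset.range (b + 1),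
        ((-1) ^ j * (c j : ℂ)) • ((F ^ j) w * (F ^ (b - j)) v)) = 0 := by
  refine ⟨fun j => ∏ l ∈ Finset.range j,
    (((b : ℝ) - l) * (n - b + l + 1) / (((l : ℝ) + 1) * (m - l))), by simp, ?_, ?_⟩
  · intro j hj
    refine Finset.prod_nonneg fun l hl => ?_
    have hl' := Finset.mem_range.mp hl
    have h1 : (0 : ℝ) ≤ (b : ℝ) - l := by
      have : (l : ℝ) ≤ b := by exact_mod_cast (by omega : l ≤ b)
      linarith
    have h2 : (0 : ℝ) ≤ (n : ℝ) - b := by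
      have : (b : ℝ) ≤ n := by exact_mod_cast hbn
      linarith
    have h3 : (0 : ℝ) ≤ (m : ℝ) - l := by
      have : (b : ℝ) ≤ m := by exact_mod_cast hbm
      linarith
    positivity
  · simp only [map_sum, map_smul, dE, smul_add, Finset.sum_add_distrib]
    rw [Finset.sum_range_succ, Finset.sum_range_succ' (fun j => _ • ((F ^ (b - j)) v * _))]
    simp only [Nat.sub_self, pow_zero, Module.End.one_apply, hEv, hEw, mul_zero, smul_zero,
      add_zero]
    rw [← Finset.sum_add_distrib]
    refine Finset.sum_eq_zero fun j hj => ?_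
    obtain ⟨d, rfl⟩ : ∃ d, b = j + 1 + d := ⟨b - (j + 1), by
      have := Finset.mem_range.mp hj; omega⟩
    have e1 : j + 1 + d - j = d + 1 := by omega
    have e2 : j + 1 + d - (j + 1) = d := by omega
    rw [e1, e2, h.raise_lower_pow_succ hv hEv, h.raise_lower_pow_succ hw hEw,
      Finset.prod_range_succ, mul_comm ((F ^ d) v), mul_smul_comm, smul_mul_assoc, smul_smul,
      smul_smul, ← add_smul]
    have hm : (m : ℂ) - j ≠ 0 := by
      have : (m : ℤ) - j ≠ 0 := by push_cast at hbm; omega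
      exact_mod_cast this
    have hj1 : (j : ℂ) + 1 ≠ 0 := by exact_mod_cast Nat.succ_ne_zero j
    convert zero_smul ℂ _
    push_cast
    field_simp
    ring

variable (𝒜 E F) in
/-- Subalgebras which are stable under the `sl₂`-action and under weight projections. -/
structure Stable [GradedAlgebra 𝒜] (A : Subalgebra ℂ R) : Prop where
  raise_mem : ∀ x ∈ A, E x ∈ A
  lower_mem : ∀ x ∈ A, F x ∈ A
  proj_mem : ∀ x ∈ A, ∀ p, GradedAlgebra.proj 𝒜 p x ∈ A

variable (𝒜 E) in
/-- The highest weight vectors of `A` are generated by those of weight at most `μ`. -/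
def HwGen (A : Subalgebra ℂ R) (μ : ℕ) : Prop :=
  ∀ p, ∀ x ∈ A, x ∈ 𝒜 p → E x = 0 →
    x ∈ Algebra.adjoin ℂ {w | w ∈ A ∧ E w = 0 ∧ ∃ k : ℤ, k ≤ μ ∧ w ∈ 𝒜 k}

lemma mem_span_mul_of_hwGen [GradedAlgebra 𝒜] (dE : ∀ x y, E (x * y) = x * E y + y * E x)
    {A : Subalgebra ℂ R} {μ : ℕ} (hA : HwGen 𝒜 E A μ) {m : ℤ} (hm : 0 < m) {w : R}
    (hwA : w ∈ A) (hw : w ∈ 𝒜 m) (hEw : E w = 0) :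
    w ∈ Submodule.span ℂ {y | ∃ γ : ℤ, 0 < γ ∧ γ ≤ μ ∧ ∃ g ∈ A, g ∈ 𝒜 γ ∧ E g = 0 ∧
      ∃ w' ∈ A, w' ∈ 𝒜 (m - γ) ∧ E w' = 0 ∧ y = g * w'} := by
  set D : ℤ → Set R := fun m => {y | ∃ γ : ℤ, 0 < γ ∧ γ ≤ μ ∧ ∃ g ∈ A, g ∈ 𝒜 γ ∧ E g = 0 ∧
      ∃ w' ∈ A, w' ∈ 𝒜 (m - γ) ∧ E w' = 0 ∧ y = g * w'} with hD
  have hE1 : E 1 = 0 := by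
    have := dE 1 1
    simpa using this
  have mul : ∀ {p q : ℤ} {x y : R}, x ∈ D p → y ∈ A → y ∈ 𝒜 q → E y = 0 →
      x * y ∈ D (p + q) := by
    rintro p q x y ⟨γ, h0, h1, g, hgA, hg, hEg, w', hwA', hw', hEw', rfl⟩ hyA hy hEy
    refine ⟨γ, h0, h1, g, hgA, hg, hEg, w' * y, A.mul_mem hwA' hyA, ?_, ?_, mul_assoc _ _ _⟩
    · have := SetLike.GradedMul.mul_mem hw' hy
      convert this using 2
      ring
    · rw [dE, hEy, hEw', mul_zero, mul_zero, add_zero]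
  have key : ∀ y ∈ Submonoid.closure {w | w ∈ A ∧ E w = 0 ∧ ∃ k : ℤ, k ≤ μ ∧ w ∈ 𝒜 k},
      y ∈ A ∧ E y = 0 ∧ ∃ p, y ∈ 𝒜 p ∧ (0 < p → y ∈ D p) := by
    intro y hy
    induction hy using Submonoid.closure_induction with
    | mem y hy =>
      obtain ⟨hyA, hEy, k, hk, hyk⟩ := hy
      exact ⟨hyA, hEy, k, hyk, fun h0 => ⟨k, h0, hk, y, hyA, hyk, hEy, 1, A.one_mem,
        by rw [sub_self]; exact SetLike.GradedOne.one_mem, hE1, (mul_one y).symm⟩⟩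
    | one => exact ⟨A.one_mem, hE1, 0, SetLike.GradedOne.one_mem, fun h => absurd h (lt_irrefl _)⟩
    | mul x y _ _ hx hy =>
      obtain ⟨hxA, hEx, p, hxp, hxD⟩ := hx
      obtain ⟨hyA, hEy, q, hyq, hyD⟩ := hy
      refine ⟨A.mul_mem hxA hyA, by rw [dE, hEx, hEy, mul_zero, mul_zero, add_zero], p + q,
        SetLike.GradedMul.mul_mem hxp hyq, fun hpq => ?_⟩
      by_cases hp : 0 < p
      · exact mul (hxD hp) hyA hyq hEy
      · rw [mul_comm, add_comm]
        exact mul (hyD (by omega)) hxA hxp hEx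
  have hadj := hA m w hwA hw hEw
  rw [← Subalgebra.mem_toSubmodule, Algebra.adjoin_eq_span] at hadj
  have hproj : ∀ y ∈ Submodule.span ℂ
      (Submonoid.closure {w | w ∈ A ∧ E w = 0 ∧ ∃ k : ℤ, k ≤ μ ∧ w ∈ 𝒜 k} : Set R),
      GradedAlgebra.proj 𝒜 m y ∈ Submodule.span ℂ (D m) := by
    intro y hy
    induction hy using Submodule.span_induction with
    | mem y hy =>
      obtain ⟨-, -, p, hp, hpD⟩ := key y hy
      rw [GradedAlgebra.proj_apply]
      by_cases hpm : p = m
      · subst hpm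
        rw [DirectSum.decompose_of_mem_same _ hp]
        exact Submodule.subset_span (hpD hm)
      · rw [DirectSum.decompose_of_mem_ne _ hp hpm]
        exact Submodule.zero_mem _
    | zero => simp
    | add x y _ _ hx hy => rw [map_add]; exact Submodule.add_mem _ hx hy
    | smul c x _ hx => rw [map_smul]; exact Submodule.smul_mem _ _ hx
  have := hproj w hadj
  rwa [GradedAlgebra.proj_apply, DirectSum.decompose_of_mem_same _ hw] at this

lemma lower_pow_mul_sub_mem (h : Sl2Graded 𝒜 E F) (dF : ∀ x y, F (x * y) = x * F y + y * F x)
    {k : ℤ} {T : Submodule ℂ R} (hT : ∀ y ∈ 𝒜 (k + 2), F y ∈ T) [SetLike.GradedMonoid 𝒜]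
    {m n : ℤ} {w v : R} (hw : w ∈ 𝒜 m) (hv : v ∈ 𝒜 n) (i j : ℕ)
    (hk : m + n = k + 2 * (i + j)) :
    (F ^ i) w * (F ^ j) v - ((-1 : ℂ) ^ i) • (w * (F ^ (i + j)) v) ∈ T := by
  induction i generalizing j with
  | zero => simp
  | succ i ih =>
    have e : (F ^ (i + 1)) w * (F ^ j) v
        = F ((F ^ i) w * (F ^ j) v) - (F ^ i) w * (F ^ (j + 1)) v := by
      rw [dF, pow_succ', pow_succ', Module.End.mul_apply, Module.End.mul_apply]
      ring
    have h1 := hT ((F ^ i) w * (F ^ j) v) (by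
      convert SetLike.GradedMul.mul_mem (h.lower_pow hw i) (h.lower_pow hv j) using 2
      push_cast at hk
      linarith)
    have h2 := ih (j + 1) (by push_cast at hk ⊢; linarith)
    have := T.sub_mem h1 h2
    convert this using 1
    rw [e, pow_succ, show i + (j + 1) = i + 1 + j by ring]
    module

end Ring
end Sl2Graded

namespace Sl2Graded

section Sup

variable {R : Type*} [CommRing R] [Algebra ℂ R] {𝒜 : ℤ → Submodule ℂ R} [GradedAlgebra 𝒜]
  {E F : Module.End ℂ R}

lemma pow_mem_of_stable {A : Subalgebra ℂ R} {D : Module.End ℂ R} (hD : ∀ x ∈ A, D x ∈ A) (n : ℕ)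
    {x : R} (hx : x ∈ A) : (D ^ n) x ∈ A := by
  induction n with
  | zero => simpa using hx
  | succ n ih => rw [pow_succ', Module.End.mul_apply]; exact hD _ ih

/-- Multiplying a descendant of a highest weight vector by a highest weight vector. -/
lemma mul_lower_pow_sub_mem (h : Sl2Graded 𝒜 E F) (dE : ∀ x y, E (x * y) = x * E y + y * E x)
    {A : Subalgebra ℂ R} (hA : Stable 𝒜 E F A) {γ m : ℤ} {g w : R} (hγ : 0 ≤ γ) (hgA : g ∈ A)
    (hg : g ∈ 𝒜 γ) (hEg : E g = 0) (hwA : w ∈ A) (hw : w ∈ 𝒜 m) (hEw : E w = 0) {j : ℕ}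
    (hj : j ≤ m) :
    ∃ l : ℝ, 0 ≤ l ∧ (j = 0 → l = 1) ∧ g * (F ^ j) w - (l : ℂ) • (F ^ j) (g * w) ∈
      Submodule.span ℂ {y | ∃ i < j, ∃ u ∈ A.toSubmodule, u ∈ 𝒜 (γ + m - 2 * j + 2 * i) ∧
        E u = 0 ∧ y = (F ^ i) u} := by
  have hEpow : ∀ (n : ℕ) (x : R), (E ^ n) (g * x) = g * (E ^ n) x := by
    intro n x
    induction n with
    | zero => simp
    | succ n ih =>
      rw [pow_succ', Module.End.mul_apply, Module.End.mul_apply, ih, dE, hEg, mul_zero, add_zero]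
  have hEgw : E (g * w) = 0 := by rw [dE, hEg, hEw, mul_zero, mul_zero, add_zero]
  have hgw : g * w ∈ 𝒜 (γ + m) := SetLike.GradedMul.mul_mem hg hw
  have e1 := h.raise_lower_pow hw hEw 0 j
  have e2 := h.raise_lower_pow hgw hEgw 0 j
  have p1 := prod_pos (m := m) (i := 0) (j := j) (by push_cast; omega)
  have p2 := prod_pos (m := γ + m) (i := 0) (j := j) (by push_cast; omega)
  set c₁ : ℝ := ∏ l ∈ Finset.range j, (((0 : ℕ) : ℝ) + l + 1) * ((m : ℝ) - (0 : ℕ) - l) with hc1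
  set c₂ : ℝ := ∏ l ∈ Finset.range j,
    (((0 : ℕ) : ℝ) + l + 1) * (((γ + m : ℤ) : ℝ) - (0 : ℕ) - l) with hc2
  have hc0 : (c₂ : ℂ) ≠ 0 := by exact_mod_cast p2.ne'
  refine ⟨c₁ / c₂, by positivity, ?_, ?_⟩
  · rintro rfl
    simp [hc1, hc2]
  · refine h.mem_span_lower (N := A.toSubmodule) hA.raise_mem hA.lower_mem ?_ ?_ ?_
    · exact Submodule.sub_mem _ (A.mul_mem hgA (pow_mem_of_stable hA.lower_mem j hwA))
        (Submodule.smul_mem _ _ (pow_mem_of_stable hA.lower_mem j (A.mul_mem hgA hwA)))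
    · refine Submodule.sub_mem _ ?_ (Submodule.smul_mem _ _ (h.lower_pow hgw j))
      convert SetLike.GradedMul.mul_mem hg (h.lower_pow hw j) using 2
      ring
    · rw [zero_add] at e1 e2
      rw [map_sub, map_smul, hEpow, e1, e2, smul_smul, pow_zero, Module.End.one_apply,
        Module.End.one_apply, mul_smul_comm]
      push_cast
      rw [div_mul_cancel₀ _ hc0, sub_self]

lemma mul_lower_pow_mem_of_lt (h : Sl2Graded 𝒜 E F)
    (dE : ∀ x y, E (x * y) = x * E y + y * E x) (dF : ∀ x y, F (x * y) = x * F y + y * F x)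
    {A B S G : Subalgebra ℂ R} (hA : Stable 𝒜 E F A) (hS : Stable 𝒜 E F S) (hAS : A ≤ S)
    (hBS : B ≤ S)
    {μ : ℕ} (hgen : HwGen 𝒜 E A μ) {k : ℤ}
    (hG : ∀ p < k, ∀ x ∈ S, x ∈ 𝒜 p → E x = 0 → x ∈ G)
    {T : Submodule ℂ R} (hGT : ∀ x ∈ G, x ∈ T) (hT : ∀ y ∈ 𝒜 (k + 2), F y ∈ T) {b : ℕ}
    (hC : ∀ b' < b, ∀ i j : ℕ, i + j = b' → ∀ m n : ℤ, m + n = k + 2 * b' →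
      ∀ w ∈ A, w ∈ 𝒜 m → E w = 0 → ∀ v ∈ B, v ∈ 𝒜 n → E v = 0 → (F ^ i) w * (F ^ j) v ∈ T)
    {m n : ℤ} (hmn : m + n = k + 2 * b) (hm : μ < m - b) (hn : b ≤ n)
    {w : R} (hwA : w ∈ A) (hw : w ∈ 𝒜 m) (hEw : E w = 0)
    {v : R} (hvB : v ∈ B) (hv : v ∈ 𝒜 n) (hEv : E v = 0) :
    w * (F ^ b) v ∈ T := by
  have hspan := mem_span_mul_of_hwGen dE hgen (by omega) hwA hw hEw
  suffices H : Submodule.span ℂ {y | ∃ γ : ℤ, 0 < γ ∧ γ ≤ μ ∧ ∃ g ∈ A, g ∈ 𝒜 γ ∧ E g = 0 ∧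
      ∃ w' ∈ A, w' ∈ 𝒜 (m - γ) ∧ E w' = 0 ∧ y = g * w'} ≤
      T.comap (LinearMap.mulRight ℂ ((F ^ b) v)) from H hspan
  rw [Submodule.span_le]
  rintro _ ⟨γ, hγ0, hγ, g, hgA, hg, hEg, w', hwA', hw', hEw', rfl⟩
  change g * w' * (F ^ b) v ∈ T
  have hgw : g * w' ∈ 𝒜 m := by
    convert SetLike.GradedMul.mul_mem hg hw' using 2
    ring
  have hEgw : E (g * w') = 0 := by rw [dE, hEg, hEw', mul_zero, mul_zero, add_zero]
  obtain ⟨c, hc0, hc, hEτ⟩ := h.exists_transvectant dE hw' hEw' hv hEv (b := b) (by omega) hn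
  set τ := ∑ j ∈ Finset.range (b + 1), ((-1) ^ j * (c j : ℂ)) • ((F ^ j) w' * (F ^ (b - j)) v)
    with hτ
  have hτG : τ ∈ G := by
    refine hG (k - γ) (by omega) τ ?_ ?_ hEτ
    · refine Subalgebra.sum_mem _ fun j _ => Subalgebra.smul_mem _ (S.mul_mem ?_ ?_) _
      · exact hAS (pow_mem_of_stable hA.lower_mem j hwA')
      · exact pow_mem_of_stable hS.lower_mem _ (hBS hvB)
    · refine Submodule.sum_mem _ fun j hj => Submodule.smul_mem _ _ ?_
      have hj' := Finset.mem_range.mp hj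
      convert SetLike.GradedMul.mul_mem (h.lower_pow hw' j) (h.lower_pow hv (b - j)) using 2
      push_cast [Nat.cast_sub (show j ≤ b by omega)]
      linarith
  have hgτ : g * τ ∈ T :=
    hGT _ (G.mul_mem (hG γ (by omega) g (hAS hgA) hg hEg) hτG)
  have term : ∀ j ∈ Finset.range (b + 1), ∃ l : ℝ, 0 ≤ l ∧ (j = 0 → l = 1) ∧
      g * ((F ^ j) w' * (F ^ (b - j)) v) - ((-1) ^ j * (l : ℂ)) • (g * w' * (F ^ b) v) ∈ T := by
    intro j hj
    have hj' := Finset.mem_range.mp hj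
    obtain ⟨l, hl, hl0, hmem⟩ := h.mul_lower_pow_sub_mem dE hA hγ0.le hgA hg hEg hwA' hw' hEw'
      (j := j) (by omega)
    refine ⟨l, hl, hl0, ?_⟩
    have h1 := h.lower_pow_mul_sub_mem dF hT hgw hv j (b - j)
      (by push_cast [Nat.cast_sub (show j ≤ b by omega)]; linarith)
    rw [show j + (b - j) = b by omega] at h1
    have h2 : (g * (F ^ j) w' - (l : ℂ) • (F ^ j) (g * w')) * (F ^ (b - j)) v ∈ T := by
      suffices H : Submodule.span ℂ {y | ∃ i < j, ∃ u ∈ A.toSubmodule,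
          u ∈ 𝒜 (γ + (m - γ) - 2 * j + 2 * i) ∧ E u = 0 ∧ y = (F ^ i) u} ≤
          T.comap (LinearMap.mulRight ℂ ((F ^ (b - j)) v)) from H hmem
      rw [Submodule.span_le]
      rintro _ ⟨i, hi, u, huA, hu, hEu, rfl⟩
      exact hC (i + (b - j)) (by omega) i (b - j) rfl _ n
        (by push_cast [Nat.cast_sub (show j ≤ b by omega)]; linarith) u huA hu hEu v hvB hv hEv
    have h3 := T.add_mem h2 (T.smul_mem (l : ℂ) h1)
    convert h3 using 1
    rw [sub_mul, smul_sub, smul_smul, smul_mul_assoc, mul_comm (l : ℂ), ← mul_assoc g ((F ^ j) w')]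
    abel
  choose! l hl hl0 hmem using term
  have hsum : g * τ - ((∑ j ∈ Finset.range (b + 1), c j * l j : ℝ) : ℂ) • (g * w' * (F ^ b) v)
      ∈ T := by
    have : g * τ - ((∑ j ∈ Finset.range (b + 1), c j * l j : ℝ) : ℂ) • (g * w' * (F ^ b) v)
        = ∑ j ∈ Finset.range (b + 1), ((-1) ^ j * (c j : ℂ)) •
          (g * ((F ^ j) w' * (F ^ (b - j)) v) - ((-1) ^ j * (l j : ℂ)) • (g * w' * (F ^ b) v)) := by
      rw [hτ, Finset.mul_sum]
      push_cast
      rw [Finset.sum_smul, ← Finset.sum_sub_distrib]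
      refine Finset.sum_congr rfl fun j _ => ?_
      rw [smul_sub, smul_smul, mul_smul_comm]
      congr 2
      have : ((-1 : ℂ) ^ j) * (-1) ^ j = 1 := by rw [← mul_pow]; simp
      linear_combination (-(c j : ℂ) * l j) * this
    rw [this]
    exact Submodule.sum_mem _ fun j hj => T.smul_mem _ (hmem j hj)
  have hpos : 0 < ∑ j ∈ Finset.range (b + 1), c j * l j := by
    rw [Finset.sum_range_succ', hc0, hl0 0 (by simp) rfl]
    have : 0 ≤ ∑ j ∈ Finset.range b, c (j + 1) * l (j + 1) := by
      refine Finset.sum_nonneg fun j hj => ?_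
      have hj' := Finset.mem_range.mp hj
      exact mul_nonneg (hc _ (by omega)) (hl _ (by simp; omega))
    linarith
  have hne : ((∑ j ∈ Finset.range (b + 1), c j * l j : ℝ) : ℂ) ≠ 0 := by exact_mod_cast hpos.ne'
  have := T.sub_mem hgτ hsum
  rw [sub_sub_cancel] at this
  exact (Submodule.smul_mem_iff _ hne).mp this

lemma Stable.mul_span_mem {A B : Subalgebra ℂ R} {x : R} (hx : x ∈ A ⊔ B) :
    x ∈ Submodule.span ℂ {y | ∃ a ∈ A, ∃ b ∈ B, y = a * b} := by
  rw [← Subalgebra.mem_toSubmodule, ← Subalgebra.mul_toSubmodule] at hx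
  induction hx using Submodule.mul_induction_on' with
  | mem_mul_mem a ha b hb => exact Submodule.subset_span ⟨a, ha, b, hb, rfl⟩
  | add x _ y _ hx hy => exact Submodule.add_mem _ hx hy

lemma Stable.span_homogeneous {A B : Subalgebra ℂ R} (hA : Stable 𝒜 E F A)
    (hB : Stable 𝒜 E F B) {x : R} (hx : x ∈ A ⊔ B) :
    x ∈ Submodule.span ℂ {y | ∃ p q, ∃ a ∈ A, a ∈ 𝒜 p ∧ ∃ b ∈ B, b ∈ 𝒜 q ∧ y = a * b} := by
  classical
  refine Submodule.span_le.mpr ?_ (Stable.mul_span_mem hx)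
  rintro _ ⟨a, ha, b, hb, rfl⟩
  rw [← DirectSum.sum_support_decompose 𝒜 a, ← DirectSum.sum_support_decompose 𝒜 b,
    Finset.sum_mul_sum]
  refine Submodule.sum_mem _ fun p _ => Submodule.sum_mem _ fun q _ => Submodule.subset_span ?_
  exact ⟨p, q, _, hA.proj_mem a ha p, SetLike.coe_mem _, _, hB.proj_mem b hb q,
    SetLike.coe_mem _, rfl⟩

lemma proj_mem_of_mem {T : Submodule ℂ R} {p k : ℤ} {x : R} (hx : x ∈ 𝒜 p)
    (h : p = k → x ∈ T) : GradedAlgebra.proj 𝒜 k x ∈ T := by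
  rw [GradedAlgebra.proj_apply]
  by_cases hpk : p = k
  · rw [DirectSum.decompose_of_mem_same _ (hpk ▸ hx)]
    exact h hpk
  · rw [DirectSum.decompose_of_mem_ne _ hx hpk]
    exact T.zero_mem

lemma Stable.sup (dE : ∀ x y, E (x * y) = x * E y + y * E x)
    (dF : ∀ x y, F (x * y) = x * F y + y * F x) {A B : Subalgebra ℂ R} (hA : Stable 𝒜 E F A)
    (hB : Stable 𝒜 E F B) : Stable 𝒜 E F (A ⊔ B) := by
  have hAS : A ≤ A ⊔ B := le_sup_left
  have hBS : B ≤ A ⊔ B := le_sup_right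
  have main : ∀ D : Module.End ℂ R, (∀ a ∈ A, ∀ b ∈ B, ∀ p q, a ∈ 𝒜 p → b ∈ 𝒜 q →
      D (a * b) ∈ A ⊔ B) → ∀ x ∈ A ⊔ B, D x ∈ A ⊔ B := by
    intro D hD x hx
    have := hA.span_homogeneous hB hx
    refine (Submodule.span_le (p := (A ⊔ B).toSubmodule.comap D)).mpr ?_ this
    rintro _ ⟨p, q, a, ha, hap, b, hb, hbq, rfl⟩
    exact hD a ha b hb p q hap hbq
  refine ⟨main E fun a ha b hb p q _ _ => ?_, main F fun a ha b hb p q _ _ => ?_,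
    fun x hx k => main (GradedAlgebra.proj 𝒜 k) (fun a ha b hb p q hap hbq => ?_) x hx⟩
  · rw [dE]
    exact add_mem (mul_mem (hAS ha) (hBS (hB.raise_mem b hb)))
      (mul_mem (hBS hb) (hAS (hA.raise_mem a ha)))
  · rw [dF]
    exact add_mem (mul_mem (hAS ha) (hBS (hB.lower_mem b hb)))
      (mul_mem (hBS hb) (hAS (hA.lower_mem a ha)))
  · exact proj_mem_of_mem (T := (A ⊔ B).toSubmodule) (SetLike.GradedMul.mul_mem hap hbq)
      fun _ => (A ⊔ B).mul_mem (hAS ha) (hBS hb)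

/-- If the highest weight vectors of `A` and `B` are generated in weights at most `μ` and `ν`,
then those of `A ⊔ B` are generated in weights at most `μ + ν`. -/
theorem HwGen.sup (h : Sl2Graded 𝒜 E F)
    (dE : ∀ x y, E (x * y) = x * E y + y * E x) (dF : ∀ x y, F (x * y) = x * F y + y * F x)
    {A B : Subalgebra ℂ R} (hA : Stable 𝒜 E F A) (hB : Stable 𝒜 E F B) {μ ν : ℕ}
    (hgA : HwGen 𝒜 E A μ) (hgB : HwGen 𝒜 E B ν) : HwGen 𝒜 E (A ⊔ B) (μ + ν) := by
  have hS := hA.sup dE dF hB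
  set S := A ⊔ B with hSdef
  have hAS : A ≤ S := le_sup_left
  have hBS : B ≤ S := le_sup_right
  set G := Algebra.adjoin ℂ {w | w ∈ S ∧ E w = 0 ∧ ∃ k : ℤ, k ≤ (μ + ν : ℕ) ∧ w ∈ 𝒜 k} with hGdef
  have hE1 : E 1 = 0 := by
    have := dE 1 1
    simpa using this
  have hEG : ∀ x ∈ G, E x = 0 := by
    intro x hx
    induction hx using Algebra.adjoin_induction with
    | mem x hx => exact hx.2.1
    | algebraMap r => rw [Algebra.algebraMap_eq_smul_one, map_smul, hE1, smul_zero]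
    | add x y _ _ hx hy => rw [map_add, hx, hy, add_zero]
    | mul x y _ _ hx hy => rw [dE, hx, hy, mul_zero, mul_zero, add_zero]
  suffices H : ∀ K : ℕ, ∀ k : ℤ, k ≤ K → ∀ x ∈ S, x ∈ 𝒜 k → E x = 0 → x ∈ G from
    fun p x hxS hx hEx => H p.toNat p (Int.self_le_toNat p) x hxS hx hEx
  intro K
  induction K with
  | zero =>
    intro k hk x hxS hx hEx
    exact Algebra.subset_adjoin ⟨hxS, hEx, k, by omega, hx⟩
  | succ K ihK =>
  intro k hk x hxS hx hEx
  rcases le_or_gt k (μ + ν : ℕ) with hkM | hkM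
  · exact Algebra.subset_adjoin ⟨hxS, hEx, k, hkM, hx⟩
  set T : Submodule ℂ R := Subalgebra.toSubmodule G ⊔ (𝒜 (k + 2)).map F with hTdef
  have hGT : ∀ x ∈ G, x ∈ T := fun x hx => Submodule.mem_sup_left hx
  have hT : ∀ y ∈ 𝒜 (k + 2), F y ∈ T :=
    fun y hy => Submodule.mem_sup_right (Submodule.mem_map_of_mem hy)
  have hGlow : ∀ p < k, ∀ x ∈ S, x ∈ 𝒜 p → E x = 0 → x ∈ G :=
    fun p hp x hxS hx hEx => ihK p (by omega) x hxS hx hEx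
  have hC : ∀ b : ℕ, ∀ i j : ℕ, i + j = b → ∀ m n : ℤ, m + n = k + 2 * b →
      ∀ w ∈ A, w ∈ 𝒜 m → E w = 0 → ∀ v ∈ B, v ∈ 𝒜 n → E v = 0 → (F ^ i) w * (F ^ j) v ∈ T := by
    intro b
    induction b using Nat.strong_induction_on with
    | _ b ihb =>
    intro i j hij m n hmn w hwA hw hEw v hvB hv hEv
    have hdiff : ∀ i j : ℕ, i + j = b →
        (F ^ i) w * (F ^ j) v - ((-1 : ℂ) ^ i) • (w * (F ^ (i + j)) v) ∈ T := fun i j hij =>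
      h.lower_pow_mul_sub_mem dF hT hw hv i j (by rw [hmn, ← hij]; push_cast; ring)
    have hb := hdiff b 0 rfl
    rw [add_zero, pow_zero, Module.End.one_apply] at hb
    have hu : ((-1 : ℂ) ^ b) ≠ 0 := pow_ne_zero _ (by norm_num)
    suffices hwv : w * (F ^ b) v ∈ T by
      have := T.add_mem (hdiff i j hij) (T.smul_mem ((-1 : ℂ) ^ i) (hij ▸ hwv))
      rwa [sub_add_cancel] at this
    suffices hcase : w * (F ^ b) v ∈ T ∨ v * (F ^ b) w ∈ T by
      rcases hcase with hwv | hvw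
      · exact hwv
      · rw [mul_comm] at hvw
        have := T.sub_mem hvw hb
        rw [sub_sub_cancel] at this
        exact (Submodule.smul_mem_iff _ hu).mp this
    rcases lt_or_ge n b with hnb | hnb
    · left
      rw [h.lower_pow_eq_zero hv hEv hnb, mul_zero]
      exact T.zero_mem
    rcases lt_or_ge m b with hmb | hmb
    · right
      rw [h.lower_pow_eq_zero hw hEw hmb, mul_zero]
      exact T.zero_mem
    rcases lt_or_ge (μ : ℤ) (m - b) with hμ | hμ
    · left
      exact h.mul_lower_pow_mem_of_lt dE dF hA hS hAS hBS hgA hGlow hGT hT ihb hmn hμ hnb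
        hwA hw hEw hvB hv hEv
    · right
      refine h.mul_lower_pow_mem_of_lt dE dF hB hS hBS hAS hgB hGlow hGT hT ?_
        (by rw [add_comm, hmn]) (by push_cast at hkM; omega) hmb hvB hv hEv hwA hw hEw
      intro b' hb' i j hij m n hmn w hwB hw hEw v hvA hv hEv
      rw [mul_comm]
      exact ihb b' hb' j i (by omega) n m (by omega) v hvA hv hEv w hwB hw hEw
  have hxT : x ∈ T := by
    have hspan := hA.span_homogeneous hB hxS
    have hle : Submodule.span ℂ {y | ∃ p q, ∃ a ∈ A, a ∈ 𝒜 p ∧ ∃ b ∈ B, b ∈ 𝒜 q ∧ y = a * b} ≤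
        T.comap (GradedAlgebra.proj 𝒜 k) := by
      rw [Submodule.span_le]
      rintro _ ⟨p, q, a, haA, ha, b, hbB, hb, rfl⟩
      change GradedAlgebra.proj 𝒜 k (a * b) ∈ T
      refine proj_mem_of_mem (SetLike.GradedMul.mul_mem ha hb) fun hpq => ?_
      obtain ⟨N₁, hN₁⟩ := h.nilE a
      obtain ⟨N₂, hN₂⟩ := h.nilE b
      have ha' := h.mem_span_lower (N := A.toSubmodule) hA.raise_mem hA.lower_mem haA ha hN₁
      have hb' := h.mem_span_lower (N := B.toSubmodule) hB.raise_mem hB.lower_mem hbB hb hN₂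
      refine (Submodule.span_le (p := T.comap (LinearMap.mulRight ℂ b))).mpr ?_ ha'
      rintro _ ⟨i, -, w, hwA, hw, hEw, rfl⟩
      refine (Submodule.span_le (p := T.comap (LinearMap.mulLeft ℂ ((F ^ i) w)))).mpr ?_ hb'
      rintro _ ⟨j, -, v, hvB, hv, hEv, rfl⟩
      exact hC (i + j) i j rfl _ _ (by push_cast; omega) w hwA hw hEw v hvB hv hEv
    have := hle hspan
    rwa [Submodule.mem_comap, GradedAlgebra.proj_apply,
      DirectSum.decompose_of_mem_same _ hx] at this
  obtain ⟨g, hg, _, ⟨y, hy, rfl⟩, rfl⟩ := Submodule.mem_sup.mp hxT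
  have hEFy : E (F y) = 0 := by
    rw [map_add, hEG g hg, zero_add] at hEx
    exact hEx
  rw [h.eq_zero_of_raise_lower (by omega) hy hEFy, map_zero, add_zero]
  exact hg

end Sup
end Sl2Graded

namespace MvPolynomial

section Weights

variable {σ τ : Type*} {M N : Type*} [AddCommMonoid M]

lemma isWeightedHomogeneous_derivation {w : σ → M} {c : M}
    {D : Derivation ℂ (MvPolynomial σ ℂ) (MvPolynomial σ ℂ)}
    (hD : ∀ v, (D (X v)).IsWeightedHomogeneous w (w v + c)) {m : M} {p : MvPolynomial σ ℂ}
    (hp : p.IsWeightedHomogeneous w m) : (D p).IsWeightedHomogeneous w (m + c) := by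
  have key : ∀ s : σ →₀ ℕ,
      (D (monomial s 1)).IsWeightedHomogeneous w (Finsupp.weight w s + c) := by
    intro s
    have hmul : ∀ f g : σ →₀ ℕ,
        (D (monomial f 1)).IsWeightedHomogeneous w (Finsupp.weight w f + c) →
        (D (monomial g 1)).IsWeightedHomogeneous w (Finsupp.weight w g + c) →
        (D (monomial (f + g) 1)).IsWeightedHomogeneous w (Finsupp.weight w (f + g) + c) := by
      intro f g hf hg
      have : (monomial (f + g) (1 : ℂ)) = monomial f 1 * monomial g 1 := by
        simp [monomial_mul]
      rw [this, Derivation.leibniz, smul_eq_mul, smul_eq_mul, map_add]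
      refine IsWeightedHomogeneous.add ?_ ?_
      · rw [add_assoc]
        exact (isWeightedHomogeneous_monomial w f 1 rfl).mul hg
      · rw [add_comm (Finsupp.weight w f), add_assoc]
        exact (isWeightedHomogeneous_monomial w g 1 rfl).mul hf
    induction s using Finsupp.induction_linear with
    | zero => simpa using isWeightedHomogeneous_zero ℂ w c
    | add f g hf hg => exact hmul f g hf hg
    | single a b =>
      induction b with
      | zero => simpa using isWeightedHomogeneous_zero ℂ w c
      | succ b ih =>
        rw [Finsupp.single_add]
        refine hmul _ _ ih ?_
        simpa [X, Finsupp.weight_apply, Finsupp.sum_single_index] using hD a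
  induction hp using IsWeightedHomogeneous.induction_on with
  | zero => simpa using isWeightedHomogeneous_zero ℂ w _
  | add p q _ _ hp hq => rw [map_add]; exact hp.add hq
  | monomial d r hr =>
    have : monomial d r = r • monomial d (1 : ℂ) := by simp [smul_monomial]
    rw [this, Derivation.map_smul, smul_eq_C_mul, ← hr]
    exact (key d).C_mul r

lemma isWeightedHomogeneous_aeval {w : σ → M} {w' : τ → M} {f : σ → MvPolynomial τ ℂ}
    (hf : ∀ v, (f v).IsWeightedHomogeneous w' (w v)) {m : M} {p : MvPolynomial σ ℂ}
    (hp : p.IsWeightedHomogeneous w m) : (aeval f p).IsWeightedHomogeneous w' m := by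
  induction hp using IsWeightedHomogeneous.induction_on with
  | zero => simpa using isWeightedHomogeneous_zero ℂ w' _
  | add p q _ _ hp hq => rw [map_add]; exact hp.add hq
  | monomial d r hr =>
    rw [aeval_monomial, algebraMap_eq, ← hr, Finsupp.weight_apply]
    exact (IsWeightedHomogeneous.prod _ _ _ fun v _ => (hf v).pow _).C_mul r

variable (σ) in
/-- The Euler operator attached to an integral weight function. -/
def weightDerivation (w : σ → ℤ) : Derivation ℂ (MvPolynomial σ ℂ) (MvPolynomial σ ℂ) :=
  mkDerivation ℂ fun v => ((w v : ℤ) : ℂ) • X v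

lemma weightDerivation_monomial (w : σ → ℤ) (s : σ →₀ ℕ) :
    weightDerivation σ w (monomial s 1) =
      ((Finsupp.weight w s : ℤ) : ℂ) • monomial s 1 := by
  have hmul : ∀ f g : σ →₀ ℕ,
      weightDerivation σ w (monomial f 1) = ((Finsupp.weight w f : ℤ) : ℂ) • monomial f 1 →
      weightDerivation σ w (monomial g 1) = ((Finsupp.weight w g : ℤ) : ℂ) • monomial g 1 →
      weightDerivation σ w (monomial (f + g) 1) =
        ((Finsupp.weight w (f + g) : ℤ) : ℂ) • monomial (f + g) 1 := by
    intro f g hf hg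
    have : (monomial (f + g) (1 : ℂ)) = monomial f 1 * monomial g 1 := by
      simp [monomial_mul]
    rw [this, Derivation.leibniz, hf, hg, map_add]
    simp only [smul_eq_C_mul, smul_eq_mul]
    push_cast
    rw [map_add]; ring
  induction s using Finsupp.induction_linear with
  | zero => simp
  | add f g hf hg => exact hmul f g hf hg
  | single a b =>
    induction b with
    | zero => simp
    | succ b ih =>
      rw [Finsupp.single_add]
      refine hmul _ _ ih ?_
      change weightDerivation σ w (X a) = _ • X a
      simp [weightDerivation, Finsupp.weight_apply, Finsupp.sum_single_index]

lemma coeff_weightDerivation (w : σ → ℤ) (s : σ →₀ ℕ) (p : MvPolynomial σ ℂ) :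
    coeff s (weightDerivation σ w p) = ((Finsupp.weight w s : ℤ) : ℂ) * coeff s p := by
  induction p using MvPolynomial.induction_on' with
  | monomial d r =>
    have : monomial d r = r • monomial d (1 : ℂ) := by simp [smul_monomial]
    rw [this, Derivation.map_smul, weightDerivation_monomial]
    classical
    rw [coeff_smul, coeff_smul, coeff_smul, coeff_monomial]
    split_ifs with h
    · subst h; simp only [smul_eq_mul]; ring
    · simp
  | add p q hp hq => rw [map_add, coeff_add, coeff_add, hp, hq]; ring

lemma weightDerivation_of_isWeightedHomogeneous {w : σ → ℤ} {k : ℤ} {p : MvPolynomial σ ℂ}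
    (hp : p.IsWeightedHomogeneous w k) : weightDerivation σ w p = (k : ℂ) • p := by
  ext s
  rw [coeff_weightDerivation, coeff_smul, smul_eq_mul]
  by_cases h : coeff s p = 0
  · simp [h]
  · rw [hp h]

lemma isWeightedHomogeneous_zero_of_weightDerivation {w : σ → ℤ} {p : MvPolynomial σ ℂ}
    (hp : weightDerivation σ w p = 0) : p.IsWeightedHomogeneous w 0 := by
  intro s hs
  have := coeff_weightDerivation w s p
  rw [hp, coeff_zero, eq_comm, mul_eq_zero] at this
  exact_mod_cast this.resolve_right hs

end Weights

section Nilpotent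

variable {σ : Type*} (D : Derivation ℂ (MvPolynomial σ ℂ) (MvPolynomial σ ℂ))

lemma exists_pow_mul_eq_zero (N : ℕ) : ∀ (n m : ℕ), n + m = N → ∀ x y : MvPolynomial σ ℂ,
    (D.toLinearMap ^ n) x = 0 → (D.toLinearMap ^ m) y = 0 →
    (D.toLinearMap ^ (n + m)) (x * y) = 0 := by
  induction N with
  | zero =>
    intro n m h x y hx hy
    obtain rfl : n = 0 := by omega
    obtain rfl : m = 0 := by omega
    have : x = 0 := by simpa using hx
    simp [this]
  | succ N ih =>
    intro n m h x y hx hy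
    rcases n with _ | n
    · have : x = 0 := by simpa using hx
      simp [this]
    rcases m with _ | m
    · have : y = 0 := by simpa using hy
      simp [this]
    have e : n + 1 + (m + 1) = (n + 1 + m) + 1 := by omega
    rw [pow_succ, Module.End.mul_apply] at hx hy
    have hl : D.toLinearMap (x * y) = x * D y + y * D x := by
      simp
    rw [e, pow_succ, Module.End.mul_apply, hl, map_add]
    have h1 := ih (n + 1) m (by omega) x (D y) (by rw [pow_succ, Module.End.mul_apply]; exact hx) hy
    have h2 := ih (m + 1) n (by omega) y (D x) (by rw [pow_succ, Module.End.mul_apply]; exact hy) hx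
    rw [show m + 1 + n = n + 1 + m by omega] at h2
    rw [h1, h2, add_zero]

lemma exists_pow_eq_zero (hD : ∀ v, ∃ n, (D.toLinearMap ^ n) (X v) = 0) (p : MvPolynomial σ ℂ) :
    ∃ n, (D.toLinearMap ^ n) p = 0 := by
  induction p using MvPolynomial.induction_on with
  | C a => exact ⟨1, by simp⟩
  | add p q hp hq =>
    obtain ⟨n, hn⟩ := hp
    obtain ⟨m, hm⟩ := hq
    refine ⟨n + m, ?_⟩
    rw [map_add, pow_add, Module.End.mul_apply, Module.End.mul_apply, hm, map_zero, add_zero,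
      ← Module.End.mul_apply, ← pow_add, add_comm, pow_add, Module.End.mul_apply, hn, map_zero]
  | mul_X p v hp =>
    obtain ⟨n, hn⟩ := hp
    obtain ⟨m, hm⟩ := hD v
    exact ⟨n + m, exists_pow_mul_eq_zero D _ n m rfl _ _ hn hm⟩

lemma hasDerivAt_eval {γ : ℂ → σ → ℂ}
    (hγ : ∀ v t, HasDerivAt (fun t => γ t v) (eval (γ t) (D (X v))) t) (p : MvPolynomial σ ℂ)
    (t : ℂ) : HasDerivAt (fun t => eval (γ t) p) (eval (γ t) (D p)) t := by
  induction p using MvPolynomial.induction_on with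
  | C a => simpa using hasDerivAt_const t a
  | add p q hp hq => simp only [map_add]; exact hp.add hq
  | mul_X p v hp =>
    have := hp.mul (hγ v t)
    simp only [map_mul, eval_X, Derivation.leibniz, map_add, smul_eq_mul]
    rw [mul_comm (γ t v), add_comm]
    exact this

end Nilpotent

end MvPolynomial

section Operators

variable {ι : Type} (ν : ι → ℕ)

/-- The polynomial functions on a space of binary forms. -/
abbrev CoeffRing : Type := MvPolynomial (Σ i : ι, Fin (ν i + 1)) ℂ

/-- The torus weight of a coefficient of a binary form. -/
def coeffWeight (v : Σ i : ι, Fin (ν i + 1)) : ℤ := ν v.1 - 2 * (v.2 : ℕ)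

/-- The torus weights of the coordinates on `V ⊕ ℂ²`. -/
def coordWeight : Var ν → ℤ := Sum.elim (coeffWeight ν) ![-1, 1]

/-- The action of the raising operator on a coefficient. -/
def raiseVar (v : Σ i : ι, Fin (ν i + 1)) : CoeffRing ν :=
  if (v.2 : ℕ) = 0 then 0
  else (-((ν v.1 : ℂ) - (v.2 : ℕ) + 1)) • X ⟨v.1, ⟨v.2 - 1, by omega⟩⟩

/-- The action of the lowering operator on a coefficient. -/
def lowerVar (v : Σ i : ι, Fin (ν i + 1)) : CoeffRing ν :=
  if h : (v.2 : ℕ) < ν v.1 then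
    (-(((v.2 : ℕ) : ℂ) + 1)) • X ⟨v.1, ⟨v.2 + 1, by omega⟩⟩
  else 0

/-- The raising operator on polynomial functions of the coefficients. -/
def raiseOp : Derivation ℂ (CoeffRing ν) (CoeffRing ν) := mkDerivation ℂ (raiseVar ν)

/-- The lowering operator on polynomial functions of the coefficients. -/
def lowerOp : Derivation ℂ (CoeffRing ν) (CoeffRing ν) := mkDerivation ℂ (lowerVar ν)

/-- The raising operator on the coordinate ring of `V ⊕ ℂ²`. -/
def raiseCoord : Derivation ℂ (CoordRing ν) (CoordRing ν) :=
  mkDerivation ℂ (Sum.elim (fun v => rename Sum.inl (raiseVar ν v)) ![X (Sum.inr 1), 0])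

/-- The lowering operator on the coordinate ring of `V ⊕ ℂ²`. -/
def lowerCoord : Derivation ℂ (CoordRing ν) (CoordRing ν) :=
  mkDerivation ℂ (Sum.elim (fun v => rename Sum.inl (lowerVar ν v)) ![0, X (Sum.inr 0)])

/-- The leading coefficient map, which evaluates the variables of a covariant at `(1, 0)`. -/
def leadCoeff : CoordRing ν →ₐ[ℂ] CoeffRing ν := aeval (Sum.elim X ![1, 0])

@[simp] lemma raiseOp_X (v) : raiseOp ν (X v) = raiseVar ν v := mkDerivation_X _ _ _
@[simp] lemma lowerOp_X (v) : lowerOp ν (X v) = lowerVar ν v := mkDerivation_X _ _ _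
@[simp] lemma raiseCoord_X_inl (v) :
    raiseCoord ν (X (Sum.inl v)) = rename Sum.inl (raiseVar ν v) := mkDerivation_X _ _ _
@[simp] lemma lowerCoord_X_inl (v) :
    lowerCoord ν (X (Sum.inl v)) = rename Sum.inl (lowerVar ν v) := mkDerivation_X _ _ _
@[simp] lemma raiseCoord_X_zero : raiseCoord ν (X (Sum.inr 0)) = X (Sum.inr 1) :=
  mkDerivation_X _ _ _
@[simp] lemma raiseCoord_X_one : raiseCoord ν (X (Sum.inr 1)) = 0 := mkDerivation_X _ _ _
@[simp] lemma lowerCoord_X_zero : lowerCoord ν (X (Sum.inr 0)) = 0 := mkDerivation_X _ _ _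
@[simp] lemma lowerCoord_X_one : lowerCoord ν (X (Sum.inr 1)) = X (Sum.inr 0) :=
  mkDerivation_X _ _ _

lemma raiseCoord_rename (p : CoeffRing ν) :
    raiseCoord ν (rename Sum.inl p) = rename Sum.inl (raiseOp ν p) := by
  induction p using MvPolynomial.induction_on with
  | C a => simp
  | add p q hp hq => simp [hp, hq]
  | mul_X p v hp => simp [hp]

lemma lowerCoord_rename (p : CoeffRing ν) :
    lowerCoord ν (rename Sum.inl p) = rename Sum.inl (lowerOp ν p) := by
  induction p using MvPolynomial.induction_on with
  | C a => simp
  | add p q hp hq => simp [hp, hq]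
  | mul_X p v hp => simp [hp]

@[simp] lemma leadCoeff_rename (p : CoeffRing ν) : leadCoeff ν (rename Sum.inl p) = p := by
  rw [leadCoeff, aeval_rename, Sum.elim_comp_inl, aeval_X_left_apply]

lemma leadCoeff_raiseCoord (p : CoordRing ν) :
    leadCoeff ν (raiseCoord ν p) = raiseOp ν (leadCoeff ν p) := by
  induction p using MvPolynomial.induction_on with
  | C a => simp [leadCoeff]
  | add p q hp hq => simp [hp, hq]
  | mul_X p v hp =>
    have hX : leadCoeff ν (raiseCoord ν (X v)) = raiseOp ν (leadCoeff ν (X v)) := by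
      rcases v with v | i
      · rw [raiseCoord_X_inl, leadCoeff_rename]; simp [leadCoeff]
      · fin_cases i <;> simp [leadCoeff]
    simp [hp, hX]

lemma raiseOp_lowerOp_sub (p : CoeffRing ν) :
    raiseOp ν (lowerOp ν p) - lowerOp ν (raiseOp ν p) = weightDerivation _ (coeffWeight ν) p := by
  have : ⁅raiseOp ν, lowerOp ν⁆ = weightDerivation _ (coeffWeight ν) := by
    refine derivation_ext fun ⟨c, i, hi⟩ => ?_
    rw [Derivation.commutator_apply, raiseOp_X, lowerOp_X, weightDerivation, mkDerivation_X]
    have h1 : raiseOp ν (lowerVar ν ⟨c, i, hi⟩) =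
        (((i : ℂ) + 1) * (ν c - i)) • X ⟨c, i, hi⟩ := by
      unfold lowerVar
      dsimp only
      split_ifs with h
      · rw [Derivation.map_smul, raiseOp_X, raiseVar]
        simp only [Nat.add_sub_cancel, Nat.succ_ne_zero, if_false, smul_smul]
        congr 1
        push_cast; ring
      · obtain rfl : i = ν c := by omega
        simp
    have h2 : lowerOp ν (raiseVar ν ⟨c, i, hi⟩) =
        ((ν c - (i : ℂ) + 1) * i) • X ⟨c, i, hi⟩ := by
      unfold raiseVar
      dsimp only
      split_ifs with h
      · simp [h]
      · obtain ⟨j, rfl⟩ : ∃ j, i = j + 1 := ⟨i - 1, by omega⟩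
        rw [Derivation.map_smul, lowerOp_X, lowerVar]
        simp only [Nat.add_sub_cancel]
        rw [dif_pos (by omega), smul_smul]
        congr 1
        push_cast; ring
    rw [h1, h2, ← sub_smul, coeffWeight]
    congr 1
    push_cast; ring
  rw [← this, Derivation.commutator_apply]

lemma raiseCoord_lowerCoord_sub (p : CoordRing ν) :
    raiseCoord ν (lowerCoord ν p) - lowerCoord ν (raiseCoord ν p) =
      weightDerivation _ (coordWeight ν) p := by
  have : ⁅raiseCoord ν, lowerCoord ν⁆ = weightDerivation _ (coordWeight ν) := by
    refine derivation_ext fun v => ?_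
    rw [Derivation.commutator_apply, weightDerivation, mkDerivation_X]
    rcases v with v | i
    · rw [lowerCoord_X_inl, raiseCoord_X_inl, raiseCoord_rename, lowerCoord_rename, ← map_sub]
      have := raiseOp_lowerOp_sub ν (X v)
      rw [weightDerivation, mkDerivation_X, raiseOp_X, lowerOp_X] at this
      rw [this]
      simp [coordWeight]
    · fin_cases i <;> simp [coordWeight]
  rw [← this, Derivation.commutator_apply]

lemma isWeightedHomogeneous_raiseVar (v) :
    (raiseVar ν v).IsWeightedHomogeneous (coeffWeight ν) (coeffWeight ν v + 2) := by
  unfold raiseVar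
  split_ifs with h
  · exact isWeightedHomogeneous_zero ℂ _ _
  · rw [smul_eq_C_mul]
    have : coeffWeight ν v + 2 = coeffWeight ν ⟨v.1, ⟨v.2 - 1, by omega⟩⟩ := by
      simp only [coeffWeight]; omega
    rw [this]
    exact (isWeightedHomogeneous_X ℂ _ _).C_mul _

lemma isWeightedHomogeneous_lowerVar (v) :
    (lowerVar ν v).IsWeightedHomogeneous (coeffWeight ν) (coeffWeight ν v - 2) := by
  unfold lowerVar
  split_ifs with h
  · rw [smul_eq_C_mul]
    have : coeffWeight ν v - 2 = coeffWeight ν ⟨v.1, ⟨v.2 + 1, by omega⟩⟩ := by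
      simp only [coeffWeight]; omega
    rw [this]
    exact (isWeightedHomogeneous_X ℂ _ _).C_mul _
  · exact isWeightedHomogeneous_zero ℂ _ _

lemma exists_raiseOp_pow_X (c : ι) (i : ℕ) (hi : i < ν c + 1) :
    ∃ n, ((raiseOp ν).toLinearMap ^ n) (X ⟨c, i, hi⟩) = 0 := by
  induction i with
  | zero => exact ⟨1, by simp [raiseVar]⟩
  | succ i ih =>
    obtain ⟨n, hn⟩ := ih (by omega)
    refine ⟨n + 1, ?_⟩
    rw [pow_succ, Module.End.mul_apply]
    change ((raiseOp ν).toLinearMap ^ n) (raiseOp ν (X _)) = 0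
    rw [raiseOp_X, raiseVar]
    simp [hn]

lemma exists_lowerOp_pow_X (c : ι) (j : ℕ) : ∀ (i : ℕ) (hi : i < ν c + 1), ν c - i = j →
    ∃ n, ((lowerOp ν).toLinearMap ^ n) (X ⟨c, i, hi⟩) = 0 := by
  induction j with
  | zero => exact fun i hi h => ⟨1, by simp [lowerVar, show ¬ i < ν c by omega]⟩
  | succ j ih =>
    intro i hi h
    obtain ⟨n, hn⟩ := ih (i + 1) (by omega) (by omega)
    refine ⟨n + 1, ?_⟩
    rw [pow_succ, Module.End.mul_apply]
    change ((lowerOp ν).toLinearMap ^ n) (lowerOp ν (X _)) = 0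
    rw [lowerOp_X, lowerVar]
    simp only [show i < ν c by omega, dif_pos, map_smul, hn, smul_zero]

lemma sl2Graded_coeffRing :
    Sl2Graded (weightedHomogeneousSubmodule ℂ (coeffWeight ν)) (raiseOp ν).toLinearMap
      (lowerOp ν).toLinearMap where
  raise hx := isWeightedHomogeneous_derivation
    (fun v => by rw [raiseOp_X]; exact isWeightedHomogeneous_raiseVar ν v) hx
  lower hx := isWeightedHomogeneous_derivation (c := -2)
    (fun v => by rw [lowerOp_X]; exact isWeightedHomogeneous_lowerVar ν v) hx
  comm {p x} hx := by
    have := raiseOp_lowerOp_sub ν x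
    rw [weightDerivation_of_isWeightedHomogeneous hx] at this
    exact sub_eq_iff_eq_add'.mp this
  nilE := exists_pow_eq_zero _ fun v => exists_raiseOp_pow_X ν v.1 v.2 v.2.2
  nilF := exists_pow_eq_zero _ fun v => exists_lowerOp_pow_X ν v.1 _ v.2 v.2.2 rfl

end Operators

section BinaryForms

lemma form_eq_sum_monomial (n : ℕ) (a : Fin (n + 1) → ℂ) :
    form n a = ∑ i : Fin (n + 1),
      monomial (Finsupp.single 0 (n - (i : ℕ)) + Finsupp.single 1 (i : ℕ)) (a i) := by
  refine Finset.sum_congr rfl fun i _ => ?_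
  rw [X_pow_eq_monomial, X_pow_eq_monomial, C_mul_monomial, monomial_mul]
  simp

lemma single_add_single_eq_iff {a b c d : ℕ} :
    (Finsupp.single (0 : Fin 2) a + Finsupp.single 1 b =
      Finsupp.single 0 c + Finsupp.single 1 d) ↔ a = c ∧ b = d := by
  constructor
  · intro h
    have h0 := DFunLike.congr_fun h 0
    have h1 := DFunLike.congr_fun h 1
    simp at h0 h1
    exact ⟨h0, h1⟩
  · rintro ⟨rfl, rfl⟩; rfl

lemma eq_single_add_single (s : Fin 2 →₀ ℕ) :
    s = Finsupp.single 0 (s 0) + Finsupp.single 1 (s 1) := by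
  ext i; fin_cases i <;> simp

lemma coeffOf_form (n : ℕ) (a : Fin (n + 1) → ℂ) : coeffOf n (form n a) = a := by
  funext j
  rw [coeffOf, form_eq_sum_monomial, coeff_sum, Finset.sum_eq_single j]
  · simp
  · intro i _ hij
    rw [coeff_monomial, if_neg]
    rw [single_add_single_eq_iff]
    exact fun h => hij (Fin.ext h.2)
  · simp

lemma form_isHomogeneous (n : ℕ) (a : Fin (n + 1) → ℂ) : (form n a).IsHomogeneous n := by
  rw [form_eq_sum_monomial]
  refine IsHomogeneous.sum _ _ _ fun i _ => isHomogeneous_monomial _ ?_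
  simp only [map_add, Finsupp.degree_single]
  omega

lemma form_coeffOf {n : ℕ} {p : MvPolynomial (Fin 2) ℂ} (hp : p.IsHomogeneous n) :
    form n (coeffOf n p) = p := by
  ext s
  by_cases hs : s 0 + s 1 = n
  · rw [eq_single_add_single s]
    have h1 : s 1 < n + 1 := by omega
    have h := congrFun (coeffOf_form n (coeffOf n p)) ⟨s 1, h1⟩
    simp only [coeffOf] at h
    rw [show s 0 = n - s 1 by omega]
    exact h
  · have hd : s.degree ≠ n := by
      rw [eq_single_add_single s]
      simpa using hs
    rw [hp.coeff_eq_zero hd, (form_isHomogeneous n _).coeff_eq_zero hd]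

lemma subst2_X (g : SL2) (i : Fin 2) :
    subst2 g (X i) = ∑ j : Fin 2, C ((g⁻¹).1 i j) * X j := aeval_X _ _

lemma subst2_isHomogeneous (g : SL2) {n : ℕ} {p : MvPolynomial (Fin 2) ℂ}
    (hp : p.IsHomogeneous n) : (subst2 g p).IsHomogeneous n := by
  refine isWeightedHomogeneous_aeval (fun i => ?_) hp
  refine IsHomogeneous.sum _ _ _ fun j _ => ?_
  exact (isHomogeneous_X ℂ j).C_mul _

lemma subst2_one : subst2 1 = AlgHom.id ℂ _ := by
  ext i : 1
  rw [subst2_X]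
  fin_cases i <;> simp

lemma subst2_mul (g h : SL2) (p : MvPolynomial (Fin 2) ℂ) :
    subst2 (g * h) p = subst2 g (subst2 h p) := by
  have : subst2 (g * h) = (subst2 g).comp (subst2 h) := by
    ext i : 1
    rw [AlgHom.comp_apply, subst2_X, subst2_X]
    simp only [map_mul, subst2_X, mul_inv_rev, Matrix.SpecialLinearGroup.coe_mul,
      algHom_C, algebraMap_eq, Matrix.mul_apply, Fin.sum_univ_two, map_add]
    ring
  rw [this, AlgHom.comp_apply]

lemma coeffAct_one (n : ℕ) (a : Fin (n + 1) → ℂ) : coeffAct 1 n a = a := by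
  rw [coeffAct, subst2_one, AlgHom.id_apply, coeffOf_form]

lemma coeffAct_mul (g h : SL2) (n : ℕ) (a : Fin (n + 1) → ℂ) :
    coeffAct (g * h) n a = coeffAct g n (coeffAct h n a) := by
  rw [coeffAct, coeffAct, coeffAct, subst2_mul,
    form_coeffOf (subst2_isHomogeneous h (form_isHomogeneous n a))]

variable {ι : Type} (ν : ι → ℕ)

lemma ptAct_one (pt : Var ν → ℂ) : ptAct ν 1 pt = pt := by
  funext v
  rcases v with ⟨c, i⟩ | i
  · simp [ptAct, coeffAct_one]
  · fin_cases i <;> simp [ptAct]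

lemma ptAct_mul (g h : SL2) (pt : Var ν → ℂ) : ptAct ν (g * h) pt = ptAct ν g (ptAct ν h pt) := by
  funext v
  rcases v with ⟨c, i⟩ | i
  · simp [ptAct, coeffAct_mul]
  · simp only [ptAct, Sum.elim_inr, Matrix.SpecialLinearGroup.coe_mul, Matrix.mul_apply,
      Fin.sum_univ_two]
    ring

lemma hasDerivAt_coeff_subst2 {γ : ℂ → SL2}
    {D : Derivation ℂ (MvPolynomial (Fin 2) ℂ) (MvPolynomial (Fin 2) ℂ)}
    (hγ : ∀ i s t, HasDerivAt (fun t => coeff s (subst2 (γ t) (X i)))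
      (coeff s (D (subst2 (γ t) (X i)))) t) (p : MvPolynomial (Fin 2) ℂ) :
    ∀ s t, HasDerivAt (fun t => coeff s (subst2 (γ t) p)) (coeff s (D (subst2 (γ t) p))) t := by
  induction p using MvPolynomial.induction_on with
  | C a =>
    intro s t
    simpa [algHom_C, algebraMap_eq] using hasDerivAt_const t (coeff s (C a))
  | add p q hp hq => intro s t; simp only [map_add, coeff_add]; exact (hp s t).add (hq s t)
  | mul_X p i hp =>
    intro s t
    have := HasDerivAt.fun_sum (u := Finset.HasAntidiagonal.antidiagonal s) fun x _ =>
      (hp x.1 t).mul (hγ i x.2 t)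
    simp only [map_mul, Derivation.leibniz, smul_eq_mul, coeff_add]
    rw [mul_comm (subst2 (γ t) (X i)), add_comm]
    simp only [coeff_mul, ← Finset.sum_add_distrib]
    exact this

/-- The upper unipotent one-parameter subgroup. -/
def upperUnip (t : ℂ) : SL2 := ⟨!![1, t; 0, 1], by simp⟩

/-- The lower unipotent one-parameter subgroup. -/
def lowerUnip (t : ℂ) : SL2 := ⟨!![1, 0; t, 1], by simp⟩

lemma coe_upperUnip (t : ℂ) : (upperUnip t).1 = !![1, t; 0, 1] := rfl

lemma coe_lowerUnip (t : ℂ) : (lowerUnip t).1 = !![1, 0; t, 1] := rfl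

lemma upperUnip_zero : upperUnip 0 = 1 := by
  ext i j; fin_cases i <;> fin_cases j <;> rfl

lemma lowerUnip_zero : lowerUnip 0 = 1 := by
  ext i j; fin_cases i <;> fin_cases j <;> rfl

lemma subst2_upperUnip_zero (t : ℂ) : subst2 (upperUnip t) (X 0) = X 0 + C (-t) * X 1 := by
  rw [subst2_X, Matrix.SpecialLinearGroup.coe_inv]
  simp [upperUnip]

lemma subst2_upperUnip_one (t : ℂ) : subst2 (upperUnip t) (X 1) = X 1 := by
  rw [subst2_X, Matrix.SpecialLinearGroup.coe_inv]
  simp [upperUnip]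

lemma subst2_lowerUnip_zero (t : ℂ) : subst2 (lowerUnip t) (X 0) = X 0 := by
  rw [subst2_X, Matrix.SpecialLinearGroup.coe_inv]
  simp [lowerUnip]

lemma subst2_lowerUnip_one (t : ℂ) : subst2 (lowerUnip t) (X 1) = C (-t) * X 0 + X 1 := by
  rw [subst2_X, Matrix.SpecialLinearGroup.coe_inv]
  simp [lowerUnip]

lemma hasDerivAt_coeff_upperUnip (p : MvPolynomial (Fin 2) ℂ) (s : Fin 2 →₀ ℕ) (t : ℂ) :
    HasDerivAt (fun t => coeff s (subst2 (upperUnip t) p))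
      (-coeff s (X 1 * pderiv 0 (subst2 (upperUnip t) p))) t := by
  have := hasDerivAt_coeff_subst2 (γ := upperUnip) (D := (-X 1 : MvPolynomial (Fin 2) ℂ) • pderiv 0)
    (fun i s t => ?_) p s t
  · simpa using this
  · fin_cases i
    · simp only [Fin.zero_eta, subst2_upperUnip_zero, coeff_add, coeff_C_mul]
      have := ((hasDerivAt_id t).neg.mul_const (coeff s (X 1 : MvPolynomial (Fin 2) ℂ))).const_add
        (coeff s (X 0 : MvPolynomial (Fin 2) ℂ))
      refine this.congr_deriv ?_
      simp [pderiv_X]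
    · simp only [Fin.mk_one, subst2_upperUnip_one]
      refine (hasDerivAt_const t _).congr_deriv ?_
      simp [pderiv_X]

lemma hasDerivAt_coeff_lowerUnip (p : MvPolynomial (Fin 2) ℂ) (s : Fin 2 →₀ ℕ) (t : ℂ) :
    HasDerivAt (fun t => coeff s (subst2 (lowerUnip t) p))
      (-coeff s (X 0 * pderiv 1 (subst2 (lowerUnip t) p))) t := by
  have := hasDerivAt_coeff_subst2 (γ := lowerUnip) (D := (-X 0 : MvPolynomial (Fin 2) ℂ) • pderiv 1)
    (fun i s t => ?_) p s t
  · simpa using this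
  · fin_cases i
    · simp only [Fin.zero_eta, subst2_lowerUnip_zero]
      refine (hasDerivAt_const t _).congr_deriv ?_
      simp [pderiv_X]
    · simp only [Fin.mk_one, subst2_lowerUnip_one, coeff_add, coeff_C_mul]
      have := ((hasDerivAt_id t).neg.mul_const (coeff s (X 0 : MvPolynomial (Fin 2) ℂ))).add_const
        (coeff s (X 1 : MvPolynomial (Fin 2) ℂ))
      refine this.congr_deriv ?_
      simp [pderiv_X]

lemma hasDerivAt_ptAct_upperUnip (pt : Var ν → ℂ) (v : Var ν) (t : ℂ) :
    HasDerivAt (fun t => ptAct ν (upperUnip t) pt v)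
      (eval (ptAct ν (upperUnip t) pt) (raiseCoord ν (X v))) t := by
  rcases v with ⟨c, i, hi⟩ | i
  · rw [raiseCoord_X_inl, eval_rename]
    have := hasDerivAt_coeff_upperUnip (form (ν c) fun k => pt (Sum.inl ⟨c, k⟩))
      (Finsupp.single 0 (ν c - i) + Finsupp.single 1 i) t
    refine HasDerivAt.congr_deriv this ?_
    rcases i with _ | i
    · simp [raiseVar, coeff_X_mul']
    · rw [Finsupp.single_add, ← add_assoc, add_comm _ (Finsupp.single 1 1), coeff_X_mul,
        coeff_pderiv, add_right_comm, ← Finsupp.single_add,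
        show ν c - (i + 1) + 1 = ν c - i by omega]
      have h : ((ν c - (i + 1) : ℕ) : ℂ) = ν c - (i + 1) := by
        rw [Nat.cast_sub (by omega)]; push_cast; ring
      simp [raiseVar, ptAct, coeffAct, coeffOf, h]
      ring
  · have h0 : ∀ t, ptAct ν (upperUnip t) pt (Sum.inr 0) = pt (Sum.inr 0) + t * pt (Sum.inr 1) := by
      simp [ptAct, upperUnip]
    have h1 : ∀ t, ptAct ν (upperUnip t) pt (Sum.inr 1) = pt (Sum.inr 1) := by
      simp [ptAct, upperUnip]
    fin_cases i
    · simp only [Fin.zero_eta, h0, raiseCoord_X_zero, eval_X, h1]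
      simpa using ((hasDerivAt_id t).mul_const (pt (Sum.inr 1))).const_add (pt (Sum.inr 0))
    · simp only [Fin.mk_one, h1, raiseCoord_X_one, map_zero]
      exact hasDerivAt_const _ _

lemma hasDerivAt_ptAct_lowerUnip (pt : Var ν → ℂ) (v : Var ν) (t : ℂ) :
    HasDerivAt (fun t => ptAct ν (lowerUnip t) pt v)
      (eval (ptAct ν (lowerUnip t) pt) (lowerCoord ν (X v))) t := by
  rcases v with ⟨c, i, hi⟩ | i
  · rw [lowerCoord_X_inl, eval_rename]
    have := hasDerivAt_coeff_lowerUnip (form (ν c) fun k => pt (Sum.inl ⟨c, k⟩))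
      (Finsupp.single 0 (ν c - i) + Finsupp.single 1 i) t
    refine HasDerivAt.congr_deriv this ?_
    by_cases h : i < ν c
    · obtain ⟨j, hj⟩ : ∃ j, ν c - i = j + 1 := ⟨ν c - i - 1, by omega⟩
      rw [hj, Finsupp.single_add, add_comm (Finsupp.single 0 j), add_assoc, coeff_X_mul,
        coeff_pderiv, add_assoc, ← Finsupp.single_add]
      simp [lowerVar, h, ptAct, coeffAct, coeffOf, show ν c - (i + 1) = j by omega,
        -Finsupp.single_add, -Finsupp.single_tsub]
      ring
    · simp [lowerVar, h, show ν c - i = 0 by omega, coeff_X_mul']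
  · have h1 : ∀ t, ptAct ν (lowerUnip t) pt (Sum.inr 1) = t * pt (Sum.inr 0) + pt (Sum.inr 1) := by
      simp [ptAct, lowerUnip]
    have h0 : ∀ t, ptAct ν (lowerUnip t) pt (Sum.inr 0) = pt (Sum.inr 0) := by
      simp [ptAct, lowerUnip]
    fin_cases i
    · simp only [Fin.zero_eta, h0, lowerCoord_X_zero, map_zero]
      exact hasDerivAt_const _ _
    · simp only [Fin.mk_one, h1, lowerCoord_X_one, eval_X, h0]
      simpa using ((hasDerivAt_id t).mul_const (pt (Sum.inr 0))).add_const (pt (Sum.inr 1))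

lemma eq_zero_of_hasDerivAt_eval {D : Derivation ℂ (CoordRing ν) (CoordRing ν)} {u : ℂ → SL2}
    (hu : u 0 = 1) (hD : ∀ pt v t, HasDerivAt (fun t => ptAct ν (u t) pt v)
      (eval (ptAct ν (u t) pt) (D (X v))) t) {p : CoordRing ν} (hp : p ∈ Covariants ν) :
    D p = 0 := by
  refine funext fun pt => ?_
  have h := hasDerivAt_eval D (hD pt) p 0
  have hc : (fun t => eval (ptAct ν (u t) pt) p) = fun _ => eval pt p := by
    funext t; exact hp _ _
  rw [hc, hu, ptAct_one] at h
  rw [map_zero]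
  exact h.unique (hasDerivAt_const _ _)

lemma eval_ptAct_of_hasDerivAt {D : Derivation ℂ (CoordRing ν) (CoordRing ν)} {u : ℂ → SL2}
    (hu : u 0 = 1) (hD : ∀ pt v t, HasDerivAt (fun t => ptAct ν (u t) pt v)
      (eval (ptAct ν (u t) pt) (D (X v))) t) {p : CoordRing ν} (hp : D p = 0) (t : ℂ)
    (pt : Var ν → ℂ) : eval (ptAct ν (u t) pt) p = eval pt p := by
  have h := hasDerivAt_eval D (hD pt) p
  simp only [hp, map_zero] at h
  have := is_const_of_deriv_eq_zero (fun t => (h t).differentiableAt) (fun t => (h t).deriv) t 0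
  rwa [hu, ptAct_one] at this

lemma SL2_induction {P : SL2 → Prop} (hmul : ∀ g h, P g → P h → P (g * h))
    (hu : ∀ t, P (upperUnip t)) (hl : ∀ t, P (lowerUnip t)) (g : SL2) : P g := by
  have hne : ∀ g : SL2, g.1 1 0 ≠ 0 → P g := by
    intro g hc
    have hdet : g.1 0 0 * g.1 1 1 - g.1 0 1 * g.1 1 0 = 1 := by
      rw [← Matrix.det_fin_two]; exact g.2
    have : g = upperUnip ((g.1 0 0 - 1) / g.1 1 0) * lowerUnip (g.1 1 0) *
        upperUnip ((g.1 1 1 - 1) / g.1 1 0) := by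
      ext i j
      simp only [Matrix.SpecialLinearGroup.coe_mul, coe_upperUnip, coe_lowerUnip,
        Matrix.mul_fin_two]
      fin_cases i <;> fin_cases j <;> simp <;> field_simp <;>
        first | ring1 | linear_combination -hdet
    rw [this]
    exact hmul _ _ (hmul _ _ (hu _) (hl _)) (hu _)
  by_cases hc : g.1 1 0 = 0
  · have hdet : g.1 0 0 * g.1 1 1 - g.1 0 1 * g.1 1 0 = 1 := by
      rw [← Matrix.det_fin_two]; exact g.2
    have : g = g * lowerUnip 1 * lowerUnip (-1) := by
      rw [mul_assoc]
      have : lowerUnip 1 * lowerUnip (-1) = 1 := by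
        ext i j
        simp only [Matrix.SpecialLinearGroup.coe_mul, coe_lowerUnip, Matrix.mul_fin_two]
        fin_cases i <;> fin_cases j <;> simp
      rw [this, mul_one]
    rw [this]
    refine hmul _ _ (hne _ ?_) (hl _)
    rw [Matrix.SpecialLinearGroup.coe_mul, Matrix.mul_apply, Fin.sum_univ_two]
    simp only [lowerUnip, hc]
    intro h
    simp at h
    simp [hc, h] at hdet
  · exact hne g hc

/-- Covariance under `SL₂` is infinitesimal covariance. -/
theorem mem_covariants_iff {p : CoordRing ν} :
    p ∈ Covariants ν ↔ raiseCoord ν p = 0 ∧ lowerCoord ν p = 0 := by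
  constructor
  · intro hp
    exact ⟨eq_zero_of_hasDerivAt_eval ν upperUnip_zero (hasDerivAt_ptAct_upperUnip ν) hp,
      eq_zero_of_hasDerivAt_eval ν lowerUnip_zero (hasDerivAt_ptAct_lowerUnip ν) hp⟩
  · rintro ⟨hE, hF⟩ g
    refine SL2_induction (P := fun g => ∀ pt, eval (ptAct ν g pt) p = eval pt p)
      (fun g h hg hh pt => ?_) (fun t pt => ?_) (fun t pt => ?_) g
    · rw [ptAct_mul, hg, hh]
    · exact eval_ptAct_of_hasDerivAt ν upperUnip_zero (hasDerivAt_ptAct_upperUnip ν) hE t pt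
    · exact eval_ptAct_of_hasDerivAt ν lowerUnip_zero (hasDerivAt_ptAct_lowerUnip ν) hF t pt

end BinaryForms

namespace MvPolynomial

variable {σ τ : Type*} {M : Type*} [AddCancelCommMonoid M]

lemma map_weightedHomogeneousComponent {w : σ → M} {w' : τ → M} {c : M}
    (T : MvPolynomial σ ℂ →ₗ[ℂ] MvPolynomial τ ℂ)
    (hT : ∀ m p, p.IsWeightedHomogeneous w m → (T p).IsWeightedHomogeneous w' (m + c)) (m : M)
    (p : MvPolynomial σ ℂ) :
    T (weightedHomogeneousComponent w m p) = weightedHomogeneousComponent w' (m + c) (T p) := by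
  induction p using MvPolynomial.induction_on' with
  | monomial d r =>
    have hd := isWeightedHomogeneous_monomial w d r rfl
    by_cases h : Finsupp.weight w d = m
    · subst h
      rw [hd.weightedHomogeneousComponent_same, (hT _ _ hd).weightedHomogeneousComponent_same]
    · rw [hd.weightedHomogeneousComponent_ne _ (Ne.symm h),
        (hT _ _ hd).weightedHomogeneousComponent_ne, map_zero]
      exact fun h' => h (add_right_cancel h').symm
  | add p q hp hq => simp only [map_add, hp, hq]

lemma mem_of_weightedHomogeneousComponent_mem {w : σ → M} {S : Submodule ℂ (MvPolynomial σ ℂ)}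
    {p : MvPolynomial σ ℂ} (h : ∀ m, weightedHomogeneousComponent w m p ∈ S) : p ∈ S := by
  rw [← sum_weightedHomogeneousComponent w p]
  exact finsum_induction (· ∈ S) S.zero_mem (fun _ _ => S.add_mem) h

lemma isWeightedHomogeneous_rename {N : Type*} [AddCommMonoid N] {f : σ → τ} {w : σ → N}
    {w' : τ → N} (hf : ∀ v, w' (f v) = w v) {m : N} {p : MvPolynomial σ ℂ}
    (hp : p.IsWeightedHomogeneous w m) : (rename f p).IsWeightedHomogeneous w' m := by
  have h : rename f p = aeval (fun v => X (f v)) p := by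
    rw [← aeval_X_left_apply (rename f p), aeval_rename]; rfl
  rw [h]
  exact isWeightedHomogeneous_aeval
    (fun v => by rw [← hf v]; exact isWeightedHomogeneous_X ℂ w' (f v)) hp

lemma isWeightedHomogeneous_zero_weight {N : Type*} [AddCommMonoid N] (p : MvPolynomial σ ℂ) :
    p.IsWeightedHomogeneous (fun _ => (0 : N)) 0 := by
  intro s _
  simp [Finsupp.weight_apply]

end MvPolynomial

section Lift

variable {ι : Type} (ν : ι → ℕ)

/-- The order of a coordinate on `V ⊕ ℂ²`. -/
def orderWeight : Var ν → ℕ := Sum.elim (fun _ => 0) fun _ => 1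

lemma weight_wBi_snd (s : Var ν →₀ ℕ) :
    (Finsupp.weight (wBi ν) s).2 = Finsupp.weight (orderWeight ν) s := by
  simp only [Finsupp.weight_apply, Finsupp.sum, Prod.snd_sum, Prod.smul_snd]
  refine Finset.sum_congr rfl fun v _ => ?_
  rcases v with v | v <;> simp [wBi, orderWeight]

lemma isWeightedHomogeneous_orderWeight {p : CoordRing ν} {d k : ℕ}
    (hp : p.IsWeightedHomogeneous (wBi ν) (d, k)) : p.IsWeightedHomogeneous (orderWeight ν) k := by
  intro s hs
  rw [← weight_wBi_snd, hp hs]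

lemma weightedHomogeneousComponent_wBi_eq_zero {p : CoordRing ν} {k : ℕ}
    (hp : p.IsWeightedHomogeneous (orderWeight ν) k) {d k' : ℕ} (hk : k' ≠ k) :
    weightedHomogeneousComponent (wBi ν) (d, k') p = 0 := by
  classical
  ext s
  rw [coeff_weightedHomogeneousComponent, coeff_zero]
  split_ifs with h
  · by_contra hs
    apply hk
    rw [← hp hs, ← weight_wBi_snd, h]
  · rfl

lemma isWeightedHomogeneous_wBi_raiseCoord {m : ℕ × ℕ} {p : CoordRing ν}
    (hp : p.IsWeightedHomogeneous (wBi ν) m) :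
    (raiseCoord ν p).IsWeightedHomogeneous (wBi ν) (m + 0) := by
  refine isWeightedHomogeneous_derivation (fun v => ?_) hp
  rw [add_zero]
  rcases v with v | i
  · rw [raiseCoord_X_inl, raiseVar]
    split_ifs
    · simpa using isWeightedHomogeneous_zero ℂ (wBi ν) _
    · rw [map_smul, rename_X, smul_eq_C_mul]
      exact (isWeightedHomogeneous_X ℂ (wBi ν) (Sum.inl _)).C_mul _
  · fin_cases i
    · simpa [wBi] using isWeightedHomogeneous_X ℂ (wBi ν) (Sum.inr 1)
    · simpa using isWeightedHomogeneous_zero ℂ (wBi ν) _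

lemma isWeightedHomogeneous_wBi_lowerCoord {m : ℕ × ℕ} {p : CoordRing ν}
    (hp : p.IsWeightedHomogeneous (wBi ν) m) :
    (lowerCoord ν p).IsWeightedHomogeneous (wBi ν) (m + 0) := by
  refine isWeightedHomogeneous_derivation (fun v => ?_) hp
  rw [add_zero]
  rcases v with v | i
  · rw [lowerCoord_X_inl, lowerVar]
    split_ifs
    · rw [map_smul, rename_X, smul_eq_C_mul]
      exact (isWeightedHomogeneous_X ℂ (wBi ν) (Sum.inl _)).C_mul _
    · simpa using isWeightedHomogeneous_zero ℂ (wBi ν) _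
  · fin_cases i
    · simpa using isWeightedHomogeneous_zero ℂ (wBi ν) _
    · simpa [wBi] using isWeightedHomogeneous_X ℂ (wBi ν) (Sum.inr 0)

lemma weightedHomogeneousComponent_mem_covariants {p : CoordRing ν} (hp : p ∈ Covariants ν)
    (m : ℕ × ℕ) : weightedHomogeneousComponent (wBi ν) m p ∈ Covariants ν := by
  rw [mem_covariants_iff] at hp ⊢
  have h1 := map_weightedHomogeneousComponent (raiseCoord ν).toLinearMap
    (fun m p => isWeightedHomogeneous_wBi_raiseCoord ν) m p
  have h2 := map_weightedHomogeneousComponent (lowerCoord ν).toLinearMap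
    (fun m p => isWeightedHomogeneous_wBi_lowerCoord ν) m p
  refine ⟨h1.trans ?_, h2.trans ?_⟩
  · change weightedHomogeneousComponent _ _ (raiseCoord ν p) = 0
    rw [hp.1, map_zero]
  · change weightedHomogeneousComponent _ _ (lowerCoord ν p) = 0
    rw [hp.2, map_zero]

lemma eval_eq_eval_leadCoeff {pt : Var ν → ℂ} (h0 : pt (Sum.inr 0) = 1) (h1 : pt (Sum.inr 1) = 0)
    (p : CoordRing ν) : eval pt p = eval (pt ∘ Sum.inl) (leadCoeff ν p) := by
  induction p using MvPolynomial.induction_on with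
  | C a => simp [leadCoeff]
  | add p q hp hq => simp [hp, hq]
  | mul_X p v hp =>
    have hX : eval pt (X v) = eval (pt ∘ Sum.inl) (leadCoeff ν (X v)) := by
      rcases v with v | i
      · simp [leadCoeff]
      · fin_cases i <;> simp [leadCoeff, h0, h1]
    rw [map_mul, map_mul, map_mul, hp, hX]

lemma eq_zero_of_leadCoeff_eq_zero {p : CoordRing ν} (hp : p ∈ Covariants ν)
    (h : leadCoeff ν p = 0) : p = 0 := by
  have key : p * X (Sum.inr 0) = 0 := by
    refine funext fun pt => ?_
    rw [map_mul, eval_X, map_zero]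
    by_cases ha : pt (Sum.inr 0) = 0
    · rw [ha, mul_zero]
    · let g : SL2 := ⟨!![(pt (Sum.inr 0))⁻¹, 0; -pt (Sum.inr 1), pt (Sum.inr 0)], by simp [ha]⟩
      have h0 : ptAct ν g pt (Sum.inr 0) = 1 := by simp [ptAct, g, ha]
      have h1 : ptAct ν g pt (Sum.inr 1) = 0 := by
        simp [ptAct, g]; ring
      rw [← hp g pt, eval_eq_eval_leadCoeff ν h0 h1, h, map_zero, zero_mul]
  exact (mul_eq_zero.mp key).resolve_right (X_ne_zero _)

lemma leadCoeff_isWeightedHomogeneous {p : CoordRing ν} (hp : p ∈ Covariants ν) {k : ℕ}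
    (hk : p.IsWeightedHomogeneous (orderWeight ν) k) :
    (leadCoeff ν p).IsWeightedHomogeneous (coeffWeight ν) (k : ℤ) := by
  rw [mem_covariants_iff] at hp
  have h0 : p.IsWeightedHomogeneous (coordWeight ν) 0 := by
    refine isWeightedHomogeneous_zero_of_weightDerivation ?_
    rw [← raiseCoord_lowerCoord_sub, hp.1, hp.2, map_zero, map_zero, sub_zero]
  have hw : p.IsWeightedHomogeneous (fun v => coordWeight ν v + orderWeight ν v) (k : ℤ) := by
    intro s hs
    have e1 := h0 hs
    have e2 := hk hs
    rw [Finsupp.weight_apply] at e1 e2 ⊢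
    simp only [smul_add, Finsupp.sum_add]
    rw [e1, zero_add, ← e2]
    simp [Finsupp.sum]
  refine isWeightedHomogeneous_aeval (fun v => ?_) hw
  rcases v with v | i
  · simpa [coordWeight, orderWeight] using isWeightedHomogeneous_X ℂ (coeffWeight ν) v
  · fin_cases i
    · simpa [coordWeight, orderWeight] using isWeightedHomogeneous_one ℂ (coeffWeight ν)
    · simpa using isWeightedHomogeneous_zero ℂ (coeffWeight ν) _

/-- The covariant of order `k` with a given highest weight vector as leading coefficient. -/
def liftCov (k : ℕ) (w : CoeffRing ν) : CoordRing ν :=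
  ∑ j ∈ Finset.range (k + 1), ((-1 : ℂ) ^ j / (j.factorial : ℂ)) •
    (rename Sum.inl (((lowerOp ν).toLinearMap ^ j) w) * (X (Sum.inr 0) ^ (k - j) *
      X (Sum.inr 1) ^ j))

lemma leadCoeff_liftCov (k : ℕ) (w : CoeffRing ν) : leadCoeff ν (liftCov ν k w) = w := by
  have h0 : leadCoeff ν (X (Sum.inr 0)) = 1 := by simp [leadCoeff]
  have h1 : leadCoeff ν (X (Sum.inr 1)) = 0 := by simp [leadCoeff]
  rw [liftCov, Finset.sum_range_succ', map_add, map_sum, Finset.sum_eq_zero]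
  · simp [h0]
  · intro j _
    simp [h0, h1]

lemma liftCov_isWeightedHomogeneous (k : ℕ) (w : CoeffRing ν) :
    (liftCov ν k w).IsWeightedHomogeneous (orderWeight ν) k := by
  refine IsWeightedHomogeneous.sum _ _ _ fun j hj => ?_
  rw [smul_eq_C_mul]
  refine IsWeightedHomogeneous.C_mul ?_ _
  have h1 := isWeightedHomogeneous_rename (f := Sum.inl) (w' := orderWeight ν) (fun v => rfl)
    (isWeightedHomogeneous_zero_weight (N := ℕ) (((lowerOp ν).toLinearMap ^ j) w))
  have h2 := (isWeightedHomogeneous_X ℂ (orderWeight ν) (Sum.inr 0)).pow (k - j)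
  have h3 := (isWeightedHomogeneous_X ℂ (orderWeight ν) (Sum.inr 1)).pow j
  have := h1.mul (h2.mul h3)
  have hj' : j ≤ k := by simpa [Nat.lt_succ_iff] using hj
  convert this using 1
  change k = 0 + ((k - j) • 1 + j • 1)
  simp [hj']

lemma liftCov_mem_covariants {k : ℕ} {w : CoeffRing ν}
    (hw : w.IsWeightedHomogeneous (coeffWeight ν) (k : ℤ)) (hE : raiseOp ν w = 0) :
    liftCov ν k w ∈ Covariants ν := by
  have hG := sl2Graded_coeffRing ν
  rw [mem_covariants_iff]
  have hfac : ∀ j : ℕ, ((-1 : ℂ) ^ (j + 1) / ((j + 1).factorial : ℂ)) * (j + 1) =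
      -((-1 : ℂ) ^ j / (j.factorial : ℂ)) := by
    intro j
    have : (j.factorial : ℂ) ≠ 0 := by exact_mod_cast j.factorial_ne_zero
    have : (j : ℂ) + 1 ≠ 0 := by exact_mod_cast j.succ_ne_zero
    rw [Nat.factorial_succ]
    push_cast
    field_simp
    ring
  constructor
  · have hterm : ∀ j, raiseCoord ν (((-1 : ℂ) ^ j / (j.factorial : ℂ)) •
        (rename Sum.inl (((lowerOp ν).toLinearMap ^ j) w) * (X (Sum.inr 0) ^ (k - j) *
          X (Sum.inr 1) ^ j))) =
        ((-1 : ℂ) ^ j / (j.factorial : ℂ)) •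
          (rename Sum.inl (raiseOp ν (((lowerOp ν).toLinearMap ^ j) w)) *
            (X (Sum.inr 0) ^ (k - j) * X (Sum.inr 1) ^ j)) +
        ((-1 : ℂ) ^ j / (j.factorial : ℂ) * ((k - j : ℕ) : ℂ)) •
          (rename Sum.inl (((lowerOp ν).toLinearMap ^ j) w) *
            (X (Sum.inr 0) ^ (k - j - 1) * X (Sum.inr 1) ^ (j + 1))) := by
      intro j
      rw [Derivation.map_smul]
      simp only [Derivation.leibniz, Derivation.leibniz_pow,
        raiseCoord_rename, raiseCoord_X_zero, raiseCoord_X_one, smul_eq_mul, smul_zero, mul_zero,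
        zero_add, nsmul_eq_mul, mul_smul, smul_eq_C_mul, map_natCast]
      ring
    rw [liftCov, map_sum, Finset.sum_congr rfl fun j _ => hterm j, Finset.sum_add_distrib,
      Finset.sum_range_succ', Finset.sum_range_succ (n := k)]
    simp only [pow_zero, Module.End.one_apply, hE, map_zero, zero_mul, smul_zero, add_zero,
      Nat.sub_self, Nat.cast_zero, mul_zero, zero_smul]
    rw [← Finset.sum_add_distrib]
    refine Finset.sum_eq_zero fun j hj => ?_
    have hjk : j < k := Finset.mem_range.mp hj
    have hr := hG.raise_lower_pow_succ hw hE j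
    have hr' : raiseOp ν (((lowerOp ν).toLinearMap ^ (j + 1)) w) =
      (((j : ℂ) + 1) * ((k : ℂ) - j)) • ((lowerOp ν).toLinearMap ^ j) w := by
      simpa using hr
    rw [hr', map_smul, smul_mul_assoc, smul_smul, ← mul_assoc, hfac,
      show k - (j + 1) = k - j - 1 by omega, Nat.cast_sub hjk.le, ← add_smul]
    ring_nf
    simp
  · have hterm : ∀ j, lowerCoord ν (((-1 : ℂ) ^ j / (j.factorial : ℂ)) •
        (rename Sum.inl (((lowerOp ν).toLinearMap ^ j) w) * (X (Sum.inr 0) ^ (k - j) *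
          X (Sum.inr 1) ^ j))) =
        ((-1 : ℂ) ^ j / (j.factorial : ℂ)) •
          (rename Sum.inl (((lowerOp ν).toLinearMap ^ (j + 1)) w) *
            (X (Sum.inr 0) ^ (k - j) * X (Sum.inr 1) ^ j)) +
        ((-1 : ℂ) ^ j / (j.factorial : ℂ) * (j : ℂ)) •
          (rename Sum.inl (((lowerOp ν).toLinearMap ^ j) w) *
            (X (Sum.inr 0) ^ (k - j + 1) * X (Sum.inr 1) ^ (j - 1))) := by
      intro j
      have : ((lowerOp ν).toLinearMap ^ (j + 1)) w =
          lowerOp ν (((lowerOp ν).toLinearMap ^ j) w) := by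
        rw [pow_succ', Module.End.mul_apply]; rfl
      rw [this]
      rw [Derivation.map_smul]
      simp only [Derivation.leibniz, Derivation.leibniz_pow,
        lowerCoord_rename, lowerCoord_X_zero, lowerCoord_X_one, smul_eq_mul, smul_zero, mul_zero,
        add_zero, nsmul_eq_mul, mul_smul, smul_eq_C_mul, map_natCast]
      ring
    rw [liftCov, map_sum, Finset.sum_congr rfl fun j _ => hterm j, Finset.sum_add_distrib,
      Finset.sum_range_succ, Finset.sum_range_succ' (n := k)]
    rw [hG.lower_pow_eq_zero hw hE (by push_cast; omega)]
    simp only [map_zero, zero_mul, smul_zero, add_zero, Nat.cast_zero, mul_zero, zero_smul]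
    rw [← Finset.sum_add_distrib]
    refine Finset.sum_eq_zero fun j hj => ?_
    have hjk : j < k := Finset.mem_range.mp hj
    push_cast
    rw [hfac, show k - (j + 1) + 1 = k - j by omega, neg_smul]
    exact add_neg_cancel _

end Lift

lemma MvPolynomial.IsWeightedHomogeneous.weightedHomogeneousComponent_mem {σ M : Type*}
    [AddCommMonoid M] {w : σ → M} {S : Submodule ℂ (MvPolynomial σ ℂ)} {m m' : M}
    {p : MvPolynomial σ ℂ} (hp : p.IsWeightedHomogeneous w m') (h : m' = m → p ∈ S) :
    weightedHomogeneousComponent w m p ∈ S := by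
  by_cases hm : m' = m
  · subst hm
    rw [hp.weightedHomogeneousComponent_same]
    exact h rfl
  · rw [hp.weightedHomogeneousComponent_ne _ (Ne.symm hm)]
    exact S.zero_mem

section Bases

open scoped Pointwise

variable {ι : Type} (ν : ι → ℕ)

/-- The subalgebra generated by the bihomogeneous covariants of order at most `M`. -/
def orderGen (M : ℕ) : Subalgebra ℂ (CoordRing ν) :=
  Algebra.adjoin ℂ {p | ∃ d k, k ≤ M ∧ p ∈ CovHom ν d k}

lemma orderGen_le (M : ℕ) : orderGen ν M ≤ Covariants ν :=
  Algebra.adjoin_le fun _ ⟨_, _, _, hp⟩ => hp.1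

/-- The bihomogeneous covariants of positive total degree. -/
def posCov : Set (CoordRing ν) := {p | ∃ d k, 0 < d + k ∧ p ∈ CovHom ν d k}

variable {ν}

lemma CovHom.mul {d k d' k' : ℕ} {p q : CoordRing ν} (hp : p ∈ CovHom ν d k)
    (hq : q ∈ CovHom ν d' k') : p * q ∈ CovHom ν (d + d') (k + k') :=
  ⟨mul_mem hp.1 hq.1, hp.2.mul hq.2⟩

lemma coe_mem_span_posCov {x : Covariants ν} (hx : x ∈ Cplus ν) :
    (x : CoordRing ν) ∈ Submodule.span ℂ (posCov ν) := by
  have : Cplus ν ≤ (Submodule.span ℂ (posCov ν)).comap (Covariants ν).val.toLinearMap :=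
    Submodule.span_le.mpr fun y ⟨d, k, h, hy⟩ => Submodule.subset_span ⟨d, k, h, y.2, hy⟩
  exact this hx

lemma mem_CplusSq_iff {x : Covariants ν} :
    x ∈ CplusSq ν ↔ (x : CoordRing ν) ∈ Submodule.span ℂ (posCov ν * posCov ν) := by
  constructor
  · intro hx
    have : CplusSq ν ≤ (Submodule.span ℂ (posCov ν * posCov ν)).comap
        (Covariants ν).val.toLinearMap := by
      refine Submodule.span_le.mpr ?_
      rintro _ ⟨y, hy, z, hz, rfl⟩
      change (y : CoordRing ν) * (z : CoordRing ν) ∈ Submodule.span ℂ (posCov ν * posCov ν)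
      rw [← Submodule.span_mul_span]
      exact Submodule.mul_mem_mul (coe_mem_span_posCov hy) (coe_mem_span_posCov hz)
    exact this hx
  · intro hx
    have : Submodule.span ℂ (posCov ν * posCov ν) ≤
        (CplusSq ν).map (Covariants ν).val.toLinearMap := by
      refine Submodule.span_le.mpr ?_
      rintro _ ⟨p, ⟨d, k, h, hp⟩, q, ⟨d', k', h', hq⟩, rfl⟩
      let a : Covariants ν := ⟨p, hp.1⟩
      let b : Covariants ν := ⟨q, hq.1⟩
      have ha : a ∈ Cplus ν := Submodule.subset_span ⟨d, k, h, hp.2⟩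
      have hb : b ∈ Cplus ν := Submodule.subset_span ⟨d', k', h', hq.2⟩
      exact Submodule.mem_map.mpr ⟨a * b, Submodule.subset_span ⟨a, ha, b, hb, rfl⟩,
        map_mul (Covariants ν).val a b⟩
    obtain ⟨y, hy, hyx⟩ := Submodule.mem_map.mp (this hx)
    have e : y = x := Subtype.ext hyx
    rwa [← e]

lemma mul_mem_span_posCov_mul {d k : ℕ} {p q : CoordRing ν} (hp : p ∈ CovHom ν d k)
    (hq : q ∈ Submodule.span ℂ (posCov ν * posCov ν)) :
    p * q ∈ Submodule.span ℂ (posCov ν * posCov ν) := by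
  refine (Submodule.span_le (p := (Submodule.span ℂ (posCov ν * posCov ν)).comap
    (LinearMap.mulLeft ℂ p))).mpr ?_ hq
  rintro _ ⟨a, ⟨d', k', h, ha⟩, b, hb, rfl⟩
  refine Submodule.subset_span ⟨p * a, ⟨d + d', k + k', by omega, CovHom.mul hp ha⟩, b, hb, ?_⟩
  exact mul_assoc p a b

/-- A minimal basis of bounded order generates the algebra of covariants. -/
lemma IsMinimalBasis.covariants_le_orderGen {κ : Type} {B : κ → Covariants ν}
    (hB : IsMinimalBasis ν B) {M : ℕ}
    (hM : ∀ x d k, (B x : CoordRing ν).IsWeightedHomogeneous (wBi ν) (d, k) → k ≤ M) :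
    Covariants ν ≤ orderGen ν M := by
  obtain ⟨hhom, -, hspan⟩ := hB
  have key : ∀ N d k, d + k = N → ∀ h ∈ CovHom ν d k, h ∈ orderGen ν M := by
    intro N
    induction N using Nat.strong_induction_on with
    | _ N ih =>
    intro d k hN h hh
    rcases Nat.eq_zero_or_pos (d + k) with h0 | hpos
    · exact Algebra.subset_adjoin ⟨d, k, by omega, hh⟩
    let h' : Covariants ν := ⟨h, hh.1⟩
    have hmem : (CplusSq ν).mkQ h' ∈ (Submodule.span ℂ (Set.range B)).map (CplusSq ν).mkQ := by
      rw [Submodule.map_span, ← Set.range_comp]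
      change _ ∈ Submodule.span ℂ (Set.range fun x => (CplusSq ν).mkQ (B x))
      rw [hspan]
      exact ⟨h', Submodule.subset_span ⟨d, k, hpos, hh.2⟩, rfl⟩
    obtain ⟨b, hb, hbh⟩ := hmem
    have hq : (h' - b : Covariants ν) ∈ CplusSq ν := by
      rw [← Submodule.Quotient.eq]
      exact hbh.symm
    rw [mem_CplusSq_iff] at hq
    let T : Submodule ℂ (CoordRing ν) :=
      (Subalgebra.toSubmodule (orderGen ν M)).comap (weightedHomogeneousComponent (wBi ν) (d, k))
    have hbT : (b : CoordRing ν) ∈ T := by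
      have : Submodule.span ℂ (Set.range B) ≤ T.comap (Covariants ν).val.toLinearMap := by
        refine Submodule.span_le.mpr ?_
        rintro _ ⟨x, rfl⟩
        obtain ⟨d', k', -, hx⟩ := hhom x
        change weightedHomogeneousComponent (wBi ν) (d, k) (B x : CoordRing ν) ∈
          Subalgebra.toSubmodule (orderGen ν M)
        exact hx.weightedHomogeneousComponent_mem fun _ =>
          Algebra.subset_adjoin ⟨d', k', hM x d' k' hx, (B x).2, hx⟩
      exact this hb
    have hqT : ((h' - b : Covariants ν) : CoordRing ν) ∈ T := by
      refine (Submodule.span_le (p := T)).mpr ?_ hq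
      rintro _ ⟨p, ⟨d₁, k₁, h₁, hp⟩, q, ⟨d₂, k₂, h₂, hq⟩, rfl⟩
      change weightedHomogeneousComponent (wBi ν) (d, k) (p * q) ∈
        Subalgebra.toSubmodule (orderGen ν M)
      refine (hp.2.mul hq.2).weightedHomogeneousComponent_mem fun e => ?_
      simp only [Prod.mk_add_mk, Prod.mk.injEq] at e
      exact (orderGen ν M).mul_mem (ih (d₁ + k₁) (by omega) d₁ k₁ rfl p hp)
        (ih (d₂ + k₂) (by omega) d₂ k₂ rfl q hq)
    have hT := T.add_mem hbT hqT
    have e : (b : CoordRing ν) + ((h' - b : Covariants ν) : CoordRing ν) = h := by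
      change (b : CoordRing ν) + (h - b) = h
      ring
    rw [e] at hT
    change weightedHomogeneousComponent (wBi ν) (d, k) h ∈ orderGen ν M at hT
    rwa [hh.2.weightedHomogeneousComponent_same] at hT
  intro h hh
  refine mem_of_weightedHomogeneousComponent_mem (w := wBi ν)
    (S := Subalgebra.toSubmodule (orderGen ν M)) fun m => ?_
  exact key _ m.1 m.2 rfl _ ⟨weightedHomogeneousComponent_mem_covariants ν hh m,
    weightedHomogeneousComponent_isWeightedHomogeneous _ _⟩

/-- If the covariants of order at most `M` generate all covariants, then the elements of minimal
bases have order at most `M`. -/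
lemma IsMinimalBasis.order_le {κ : Type} {B : κ → Covariants ν} (hB : IsMinimalBasis ν B) {M : ℕ}
    (hM : Covariants ν ≤ orderGen ν M) {x : κ} {d k : ℕ}
    (hx : (B x : CoordRing ν).IsWeightedHomogeneous (wBi ν) (d, k)) : k ≤ M := by
  by_contra! hk
  set D := Submodule.span ℂ (posCov ν * posCov ν) with hD
  have hcl : ∀ y ∈ Submonoid.closure {p | ∃ d k, k ≤ M ∧ p ∈ CovHom ν d k},
      ∃ d' k', y ∈ CovHom ν d' k' ∧ (k' ≤ M ∨ y ∈ D) := by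
    intro y hy
    induction hy using Submonoid.closure_induction with
    | mem y hy =>
      obtain ⟨d', k', hk', hy⟩ := hy
      exact ⟨d', k', hy, Or.inl hk'⟩
    | one => exact ⟨0, 0, ⟨one_mem _, isWeightedHomogeneous_one _ _⟩, Or.inl (Nat.zero_le _)⟩
    | mul y z _ _ hy hz =>
      obtain ⟨d₁, k₁, hy, hy'⟩ := hy
      obtain ⟨d₂, k₂, hz, hz'⟩ := hz
      refine ⟨d₁ + d₂, k₁ + k₂, CovHom.mul hy hz, ?_⟩
      rcases hz' with hz' | hz'
      · rcases hy' with hy' | hy'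
        · rw [or_iff_not_imp_left]
          intro hlt
          exact Submodule.subset_span
            ⟨y, ⟨d₁, k₁, by omega, hy⟩, z, ⟨d₂, k₂, by omega, hz⟩, rfl⟩
        · right
          rw [mul_comm]
          exact mul_mem_span_posCov_mul hz hy'
      · exact Or.inr (mul_mem_span_posCov_mul hy hz')
  have hxD : (B x : CoordRing ν) ∈ D := by
    have hxg : (B x : CoordRing ν) ∈ Subalgebra.toSubmodule (orderGen ν M) := hM (B x).2
    rw [orderGen, Algebra.adjoin_eq_span] at hxg
    have := (Submodule.span_le (p := D.comap (weightedHomogeneousComponent (wBi ν) (d, k)))).mpr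
      (fun y hy => ?_) hxg
    · rw [Submodule.mem_comap, hx.weightedHomogeneousComponent_same] at this
      exact this
    · obtain ⟨d', k', hy, hy'⟩ := hcl y hy
      refine hy.2.weightedHomogeneousComponent_mem fun e => hy'.resolve_left ?_
      simp only [Prod.mk.injEq] at e
      omega
  refine hB.2.1.ne_zero x ?_
  rw [Submodule.mkQ_apply, Submodule.Quotient.mk_eq_zero, mem_CplusSq_iff]
  exact hxD

end Bases

section HighestWeight

variable {ι : Type} (ν : ι → ℕ)

/-- The highest weight vectors of `A` are generated by those of weight at most `M`. -/
abbrev CoeffHwGen (A : Subalgebra ℂ (CoeffRing ν)) (M : ℕ) : Prop :=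
  Sl2Graded.HwGen (weightedHomogeneousSubmodule ℂ (coeffWeight ν)) (raiseOp ν).toLinearMap A M

lemma isWeightedHomogeneous_raiseOp {m : ℤ} {p : CoeffRing ν}
    (hp : p.IsWeightedHomogeneous (coeffWeight ν) m) :
    (raiseOp ν p).IsWeightedHomogeneous (coeffWeight ν) (m + 2) :=
  (sl2Graded_coeffRing ν).raise hp

lemma raiseOp_leadCoeff {p : CoordRing ν} (hp : p ∈ Covariants ν) :
    raiseOp ν (leadCoeff ν p) = 0 := by
  rw [← leadCoeff_raiseCoord, ((mem_covariants_iff ν).mp hp).1, map_zero]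

lemma liftCov_mem_orderGen {k M : ℕ} (hk : k ≤ M) {w : CoeffRing ν}
    (hw : w.IsWeightedHomogeneous (coeffWeight ν) (k : ℤ)) (hE : raiseOp ν w = 0) :
    liftCov ν k w ∈ orderGen ν M := by
  refine mem_of_weightedHomogeneousComponent_mem (w := wBi ν)
    (S := Subalgebra.toSubmodule (orderGen ν M)) fun m => ?_
  obtain ⟨d, k'⟩ := m
  by_cases hkk : k' = k
  · subst hkk
    exact Algebra.subset_adjoin ⟨d, k', hk,
      weightedHomogeneousComponent_mem_covariants ν (liftCov_mem_covariants ν hw hE) _,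
      weightedHomogeneousComponent_isWeightedHomogeneous _ _⟩
  · rw [weightedHomogeneousComponent_wBi_eq_zero ν (liftCov_isWeightedHomogeneous ν k w) hkk]
    exact Submodule.zero_mem _

/-- Generators of the covariants yield generators of the highest weight vectors. -/
lemma coeffHwGen_top_of_covariants_le {M : ℕ} (h : Covariants ν ≤ orderGen ν M) :
    CoeffHwGen ν ⊤ M := by
  intro p x _ hx hE
  rcases lt_or_ge p 0 with hp | hp
  · rw [(sl2Graded_coeffRing ν).eq_zero_of_neg hp hx hE]
    exact Subalgebra.zero_mem _
  obtain ⟨k, rfl⟩ := Int.eq_ofNat_of_zero_le hp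
  have hmem := h (liftCov_mem_covariants ν hx hE)
  have := Subalgebra.mem_map.mpr ⟨_, hmem, leadCoeff_liftCov ν k x⟩
  rw [orderGen, AlgHom.map_adjoin] at this
  refine Algebra.adjoin_mono ?_ this
  rintro _ ⟨q, ⟨d, k', hk', hq⟩, rfl⟩
  exact ⟨Algebra.mem_top, raiseOp_leadCoeff ν hq.1, k', by exact_mod_cast hk',
    leadCoeff_isWeightedHomogeneous ν hq.1 (isWeightedHomogeneous_orderWeight ν hq.2)⟩

/-- Generators of the highest weight vectors yield generators of the covariants. -/
lemma covariants_le_of_coeffHwGen_top {M : ℕ} (h : CoeffHwGen ν ⊤ M) :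
    Covariants ν ≤ orderGen ν M := by
  intro x hx
  have hmem : leadCoeff ν x ∈ (orderGen ν M).map (leadCoeff ν) := by
    refine mem_of_weightedHomogeneousComponent_mem (w := coeffWeight ν)
      (S := Subalgebra.toSubmodule ((orderGen ν M).map (leadCoeff ν))) fun m => ?_
    have hE : raiseOp ν (weightedHomogeneousComponent (coeffWeight ν) m (leadCoeff ν x)) = 0 := by
      have := map_weightedHomogeneousComponent (raiseOp ν).toLinearMap
        (fun m p => isWeightedHomogeneous_raiseOp ν) m (leadCoeff ν x)
      refine this.trans ?_
      change weightedHomogeneousComponent _ _ (raiseOp ν (leadCoeff ν x)) = 0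
      rw [raiseOp_leadCoeff ν hx, map_zero]
    have hgen := h m _ Algebra.mem_top (weightedHomogeneousComponent_mem _ _ _) hE
    refine Algebra.adjoin_le ?_ hgen
    rintro w ⟨-, hw, k, hk, hwk⟩
    rcases lt_or_ge k 0 with hneg | hpos
    · rw [(sl2Graded_coeffRing ν).eq_zero_of_neg hneg hwk hw]
      exact Subalgebra.zero_mem _
    · obtain ⟨k, rfl⟩ := Int.eq_ofNat_of_zero_le hpos
      exact Subalgebra.mem_map.mpr ⟨_, liftCov_mem_orderGen ν (by exact_mod_cast hk) hwk hw,
        leadCoeff_liftCov ν k w⟩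
  obtain ⟨y, hy, hyx⟩ := Subalgebra.mem_map.mp hmem
  have hxy := eq_zero_of_leadCoeff_eq_zero ν (sub_mem (orderGen_le ν M hy) hx)
    (by rw [map_sub]; exact sub_eq_zero.mpr hyx)
  rwa [← sub_eq_zero.mp hxy]

/-- The inclusion of the polynomial functions on one summand of a space of binary forms. -/
def summandMap (i : ι) : CoeffRing (fun _ : Fin 1 => ν i) →ₐ[ℂ] CoeffRing ν :=
  rename fun v => ⟨i, v.2⟩

lemma summandMap_injective (i : ι) : Function.Injective (summandMap ν i) := by
  refine rename_injective _ ?_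
  rintro ⟨a, b⟩ ⟨a', b'⟩ h
  obtain rfl := Subsingleton.elim a a'
  simpa using h

lemma raiseOp_summandMap (i : ι) (p : CoeffRing fun _ : Fin 1 => ν i) :
    raiseOp ν (summandMap ν i p) = summandMap ν i (raiseOp _ p) := by
  induction p using MvPolynomial.induction_on with
  | C a => simp [summandMap]
  | add p q hp hq => simp [hp, hq]
  | mul_X p v hp =>
    have hX : raiseOp ν (summandMap ν i (X v)) = summandMap ν i (raiseOp _ (X v)) := by
      simp only [summandMap, rename_X, raiseOp_X, raiseVar]
      split_ifs <;> simp
    simp only [map_mul, Derivation.leibniz, hp, hX, map_add, smul_eq_mul]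

lemma lowerOp_summandMap (i : ι) (p : CoeffRing fun _ : Fin 1 => ν i) :
    lowerOp ν (summandMap ν i p) = summandMap ν i (lowerOp _ p) := by
  induction p using MvPolynomial.induction_on with
  | C a => simp [summandMap]
  | add p q hp hq => simp [hp, hq]
  | mul_X p v hp =>
    have hX : lowerOp ν (summandMap ν i (X v)) = summandMap ν i (lowerOp _ (X v)) := by
      simp only [summandMap, rename_X, lowerOp_X, lowerVar]
      split_ifs <;> simp
    simp only [map_mul, Derivation.leibniz, hp, hX, map_add, smul_eq_mul]

lemma weightedHomogeneousComponent_summandMap (i : ι) (m : ℤ)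
    (p : CoeffRing fun _ : Fin 1 => ν i) :
    weightedHomogeneousComponent (coeffWeight ν) m (summandMap ν i p) =
      summandMap ν i (weightedHomogeneousComponent (coeffWeight _) m p) := by
  have := map_weightedHomogeneousComponent (c := 0) (w' := coeffWeight ν)
    (summandMap ν i).toLinearMap (fun m p hp => by
      rw [add_zero]
      exact isWeightedHomogeneous_rename (fun v => rfl) hp) m p
  rw [add_zero] at this
  exact this.symm

lemma CoeffHwGen.range_summandMap {i : ι} {M : ℕ}
    (h : CoeffHwGen (fun _ : Fin 1 => ν i) ⊤ M) : CoeffHwGen ν (summandMap ν i).range M := by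
  rintro p _ ⟨y, rfl⟩ hx hE
  have hEy : raiseOp _ y = 0 := by
    refine summandMap_injective ν i ?_
    rw [← raiseOp_summandMap, map_zero]
    exact hE
  have hy : y.IsWeightedHomogeneous (coeffWeight _) p := by
    have : weightedHomogeneousComponent (coeffWeight _) p y = y := by
      refine summandMap_injective ν i ?_
      rw [← weightedHomogeneousComponent_summandMap]
      exact IsWeightedHomogeneous.weightedHomogeneousComponent_same hx
    rw [← this]
    exact weightedHomogeneousComponent_isWeightedHomogeneous _ _
  have := Subalgebra.mem_map.mpr
    ⟨y, h p y Algebra.mem_top hy hEy, (rfl : summandMap ν i y = summandMap ν i y)⟩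
  rw [AlgHom.map_adjoin] at this
  refine Algebra.adjoin_mono ?_ this
  rintro _ ⟨w, ⟨-, hEw, k, hk, hw⟩, rfl⟩
  refine ⟨⟨w, rfl⟩, ?_, k, hk, isWeightedHomogeneous_rename (fun v => rfl) hw⟩
  change raiseOp ν (summandMap ν i w) = 0
  have hEw' : raiseOp (fun _ : Fin 1 => ν i) w = 0 := hEw
  rw [raiseOp_summandMap, hEw', map_zero]

instance : GradedAlgebra (weightedHomogeneousSubmodule ℂ (coeffWeight ν)) :=
  weightedGradedAlgebra ℂ (coeffWeight ν)

lemma proj_eq_weightedHomogeneousComponent (m : ℤ) (p : CoeffRing ν) :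
    GradedAlgebra.proj (weightedHomogeneousSubmodule ℂ (coeffWeight ν)) m p =
      weightedHomogeneousComponent (coeffWeight ν) m p :=
  weightedDecomposition.decompose'_apply ℂ (coeffWeight ν) p m

/-- Subalgebras stable under the `sl₂`-action and under weight projections. -/
abbrev CoeffStable (A : Subalgebra ℂ (CoeffRing ν)) : Prop :=
  Sl2Graded.Stable (weightedHomogeneousSubmodule ℂ (coeffWeight ν)) (raiseOp ν).toLinearMap
    (lowerOp ν).toLinearMap A

lemma coeffStable_range_summandMap (i : ι) : CoeffStable ν (summandMap ν i).range where
  raise_mem := by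
    rintro _ ⟨y, rfl⟩
    exact ⟨_, (raiseOp_summandMap ν i y).symm⟩
  lower_mem := by
    rintro _ ⟨y, rfl⟩
    exact ⟨_, (lowerOp_summandMap ν i y).symm⟩
  proj_mem := by
    rintro _ ⟨y, rfl⟩ p
    rw [proj_eq_weightedHomogeneousComponent]
    exact ⟨_, (weightedHomogeneousComponent_summandMap ν i p y).symm⟩

lemma coeffStable_bot : CoeffStable ν ⊥ where
  raise_mem := by
    rintro x hx
    obtain ⟨c, rfl⟩ := Algebra.mem_bot.mp hx
    change raiseOp ν (algebraMap ℂ _ c) ∈ _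
    rw [Derivation.map_algebraMap]
    exact Subalgebra.zero_mem _
  lower_mem := by
    rintro x hx
    obtain ⟨c, rfl⟩ := Algebra.mem_bot.mp hx
    change lowerOp ν (algebraMap ℂ _ c) ∈ _
    rw [Derivation.map_algebraMap]
    exact Subalgebra.zero_mem _
  proj_mem := by
    rintro x hx p
    rw [proj_eq_weightedHomogeneousComponent]
    obtain ⟨c, rfl⟩ := Algebra.mem_bot.mp hx
    exact (isWeightedHomogeneous_C (coeffWeight ν) c).weightedHomogeneousComponent_mem
      (S := Subalgebra.toSubmodule (⊥ : Subalgebra ℂ (CoeffRing ν))) fun _ => hx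

lemma coeffHwGen_sum_summandMap {μ : ι → ℕ} (h : ∀ i, CoeffHwGen (fun _ : Fin 1 => ν i) ⊤ (μ i))
    (S : Finset ι) : CoeffStable ν (⨆ i ∈ S, (summandMap ν i).range) ∧
      CoeffHwGen ν (⨆ i ∈ S, (summandMap ν i).range) (∑ i ∈ S, μ i) := by
  classical
  induction S using Finset.induction_on with
  | empty =>
    simp only [Finset.notMem_empty, iSup_false, iSup_bot, Finset.sum_empty]
    exact ⟨coeffStable_bot ν, fun p x hx _ _ => (bot_le : ⊥ ≤ Algebra.adjoin ℂ _) hx⟩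
  | insert a S ha ih =>
    rw [Finset.iSup_insert, Finset.sum_insert ha]
    have dE : ∀ x y, (raiseOp ν).toLinearMap (x * y) =
        x * (raiseOp ν).toLinearMap y + y * (raiseOp ν).toLinearMap x := (raiseOp ν).leibniz
    have dF : ∀ x y, (lowerOp ν).toLinearMap (x * y) =
        x * (lowerOp ν).toLinearMap y + y * (lowerOp ν).toLinearMap x := (lowerOp ν).leibniz
    have hA := coeffStable_range_summandMap ν a
    exact ⟨Sl2Graded.Stable.sup dE dF hA ih.1,
      Sl2Graded.HwGen.sup (sl2Graded_coeffRing ν) dE dF hA ih.1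
        (CoeffHwGen.range_summandMap ν (h a)) ih.2⟩

lemma coeffHwGen_top_sum [Fintype ι] {μ : ι → ℕ}
    (h : ∀ i, CoeffHwGen (fun _ : Fin 1 => ν i) ⊤ (μ i)) : CoeffHwGen ν ⊤ (∑ i, μ i) := by
  have := (coeffHwGen_sum_summandMap ν h Finset.univ).2
  convert this
  rw [eq_comm, eq_top_iff, ← adjoin_range_X, Algebra.adjoin_le_iff]
  rintro _ ⟨v, rfl⟩
  refine (le_iSup₂_of_le v.1 (Finset.mem_univ _) le_rfl :
    (summandMap ν v.1).range ≤ ⨆ i ∈ Finset.univ, (summandMap ν i).range) ⟨X ⟨0, v.2⟩, ?_⟩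
  exact rename_X _ _

end HighestWeight

/-- **Order bound for minimal bases of joint covariants.** Let
`V = S_{n 0} ⊕ … ⊕ S_{n (s-1)}` and, for each `i`, let `μ i` be the maximal order of
an element of a minimal basis of `Cov(S_{n i})`. Then every element `h` of a minimal
basis of `Cov(V)` satisfies `ord(h) ≤ μ 0 + … + μ (s-1)`. -/
theorem minimal_basis_order_bound
    (s : ℕ) (n : Fin s → ℕ) (μ : Fin s → ℕ)
    (hμ : ∀ i : Fin s,
      ∃ (κ : Type) (B : κ → ↥(Covariants (fun _ : Fin 1 => n i))),
        IsMinimalBasis (fun _ : Fin 1 => n i) B ∧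
        (∀ (x : κ) (d k : ℕ),
          ((B x : CoordRing (fun _ : Fin 1 => n i))).IsWeightedHomogeneous
            (wBi (fun _ : Fin 1 => n i)) (d, k) → k ≤ μ i) ∧
        (∃ (x : κ) (d : ℕ),
          ((B x : CoordRing (fun _ : Fin 1 => n i))).IsWeightedHomogeneous
            (wBi (fun _ : Fin 1 => n i)) (d, μ i))) :
    ∀ (κ : Type) (B : κ → ↥(Covariants n)), IsMinimalBasis n B →
      ∀ (x : κ) (d k : ℕ),
        ((B x : CoordRing n)).IsWeightedHomogeneous (wBi n) (d, k) →
          k ≤ ∑ i, μ i := by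
  intro κ B hB x d k hx
  refine hB.order_le (covariants_le_of_coeffHwGen_top n (coeffHwGen_top_sum n fun i => ?_)) hx
  obtain ⟨κ', B', hB', hle, -⟩ := hμ i
  exact coeffHwGen_top_of_covariants_le _ (hB'.covariants_le_orderGen hle)
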